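/- arXiv:1003.3998 — 4 statements merged into one kernel-verified Lean document; each statement's English description precedes it below -/
import Mathlib

section
/- Let G be an infinite countable amenable group, let H be a countable group, and let A be a common finite subgroup of G and H. If H contains a finite index normal subgroup N with N ∩ A = {1}, then the amalgamated free product G ∗_A H belongs to the class 𝒜. -/
/-- A `G`-invariant mean on `X`, for the `G`-action on `X` given by `φ`:
a finitely additive probability "measure" on the subsets of `X` invariant under `G`. -/
def IsInvariantMean {G X : Type*} [Group G] (φ : G →* Equiv.Perm X)
    (μ : Set X → ℝ) : Prop :=
  (∀ S : Set X, 0 ≤ μ S) ∧ μ Set.univ = 1 ∧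
  (∀ S T : Set X, Disjoint S T → μ (S ∪ T) = μ S + μ T) ∧
  (∀ (g : G) (S : Set X), μ ((φ g) '' S) = μ S)

/-- The action of `G` on `X` given by `φ` is amenable: there is a `G`-invariant mean on `X`. -/
def AmenableAction {G X : Type*} [Group G] (φ : G →* Equiv.Perm X) : Prop :=
  ∃ μ : Set X → ℝ, IsInvariantMean φ μ

/-- A group is amenable if its left-translation action on itself is amenable. -/
def AmenableGroup (G : Type*) [Group G] : Prop :=
  AmenableAction (MulAction.toPermHom G G)

/-- A group `G` is in the class `𝒜` if it admits a transitive, faithful and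
amenable action on some countable set. -/
def InClassA (G : Type*) [Group G] : Prop :=
  ∃ (X : Type) (_ : Countable X) (φ : G →* Equiv.Perm X),
    Function.Injective φ ∧ (∀ x y : X, ∃ g : G, φ g x = y) ∧ AmenableAction φ

/-- `(P, jG, jH)` is the amalgamated free product of `G` and `H` over `A`
(along the homomorphisms `iG : A →* G` and `iH : A →* H`), i.e. it is a pushout
of `iG` and `iH` in the category of groups. -/
def IsAmalgamatedProduct {A G H P : Type*} [Group A] [Group G] [Group H] [Group P]
    (iG : A →* G) (iH : A →* H) (jG : G →* P) (jH : H →* P) : Prop :=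
  jG.comp iG = jH.comp iH ∧
  ∀ (L : Type) [Group L] (fG : G →* L) (fH : H →* L),
    fG.comp iG = fH.comp iH → ∃! f : P →* L, f.comp jG = fG ∧ f.comp jH = fH

open Function

/-- A nonnegative finitely additive set function. -/
structure IsFinAdditive {Z : Type*} (ν : Set Z → ℝ) : Prop where
  nonneg : ∀ S, 0 ≤ ν S
  union : ∀ S T, Disjoint S T → ν (S ∪ T) = ν S + ν T

namespace IsFinAdditive

variable {Z : Type*} {ν : Set Z → ℝ}

theorem empty (hν : IsFinAdditive ν) : ν ∅ = 0 := by
  have := hν.union ∅ ∅ (by simp)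
  simp only [Set.union_empty] at this
  linarith

theorem mono (hν : IsFinAdditive ν) {S T : Set Z} (h : S ⊆ T) : ν S ≤ ν T := by
  have := hν.union S (T \ S) Set.disjoint_sdiff_right
  rw [Set.union_sdiff_cancel h] at this
  linarith [hν.nonneg (T \ S)]

theorem biUnion (hν : IsFinAdditive ν) {ι : Type*} (s : Finset ι) (S : ι → Set Z)
    (hS : Pairwise (Disjoint on S)) : ν (⋃ i ∈ s, S i) = ∑ i ∈ s, ν (S i) := by
  classical
  induction s using Finset.induction_on with
  | empty => simp [hν.empty]
  | insert a s ha ih =>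
    rw [Finset.set_biUnion_insert, Finset.sum_insert ha, hν.union, ih]
    rw [Set.disjoint_iUnion₂_right]
    exact fun i hi => hS fun h => ha (h ▸ hi)

/-- Splitting a set along the fibres of a function with finite codomain. -/
theorem eq_sum_fiber (hν : IsFinAdditive ν) {ι : Type*} [Fintype ι] (f : Z → ι) (S : Set Z) :
    ν S = ∑ i, ν {z | f z = i ∧ z ∈ S} := by
  rw [← hν.biUnion Finset.univ (fun i => {z | f z = i ∧ z ∈ S})]
  · congr 1
    ext z
    simp
  · intro i j hij
    rw [onFun, Set.disjoint_left]
    rintro z ⟨rfl, _⟩ ⟨h, _⟩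
    exact hij h

theorem finite_eq_zero (hν : IsFinAdditive ν) (h : ∀ z, ν {z} = 0) {F : Set Z} (hF : F.Finite) :
    ν F = 0 := by
  induction F, hF using Set.Finite.induction_on with
  | empty => exact hν.empty
  | @insert a s ha _ ih =>
    rw [Set.insert_eq, hν.union _ _ (by simpa using ha), h, ih, add_zero]

theorem congr_of_finite (hν : IsFinAdditive ν) (h : ∀ z, ν {z} = 0) {F S T : Set Z}
    (hF : F.Finite) (hST : S \ F = T \ F) : ν S = ν T := by
  have key : ∀ U : Set Z, ν U = ν (U \ F) := fun U => by
    rw [← Set.sdiff_union_inter U F,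
      hν.union _ _ (Set.disjoint_left.2 fun z hz hz' => hz.2 hz'.2),
      hν.finite_eq_zero h (hF.subset Set.inter_subset_right), add_zero,
      Set.sdiff_union_inter]
  rw [key S, key T, hST]

end IsFinAdditive

/-- The permutations leaving a set function invariant. -/
def preservingPerms {Z : Type*} (ν : Set Z → ℝ) : Subgroup (Equiv.Perm Z) where
  carrier := {θ | ∀ S, ν (θ ⁻¹' S) = ν S}
  one_mem' := fun _ => rfl
  mul_mem' := fun {a b} ha hb S => by
    rw [Equiv.Perm.coe_mul, Set.preimage_comp, hb, ha]
  inv_mem' := fun {a} ha S => by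
    rw [← ha ((a⁻¹ : Equiv.Perm Z) ⁻¹' S), ← Set.preimage_comp, ← Equiv.Perm.coe_mul,
      inv_mul_cancel]
    rfl

theorem mem_preservingPerms {Z : Type*} {ν : Set Z → ℝ} {θ : Equiv.Perm Z} :
    θ ∈ preservingPerms ν ↔ ∀ S, ν (θ ⁻¹' S) = ν S := Iff.rfl

theorem IsFinAdditive.mem_preservingPerms_of_finite {Z : Type*} {ν : Set Z → ℝ}
    (hν : IsFinAdditive ν) (h : ∀ z, ν {z} = 0) {θ : Equiv.Perm Z}
    (hθ : {z | θ z ≠ z}.Finite) : θ ∈ preservingPerms ν := fun S => by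
  refine hν.congr_of_finite h hθ ?_
  ext z
  simp only [Set.mem_sdiff, Set.mem_preimage, Set.mem_ofPred_eq, not_not]
  constructor <;> rintro ⟨h1, h2⟩ <;> simp_all

/-- A point whose orbit has positive mean and trivial pointwise stabiliser witnesses membership
in the class `𝒜`. -/
theorem inClassA_of_orbit {P Z : Type} [Group P] [Countable P] (ψ : P →* Equiv.Perm Z)
    {ν : Set Z → ℝ} (hν : IsFinAdditive ν) (hψ : ψ.range ≤ preservingPerms ν) (x : Z)
    (hpos : 0 < ν (Set.range fun p => ψ p x))
    (hfaith : ∀ p, (∀ q, ψ p (ψ q x) = ψ q x) → p = 1) : InClassA P := by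
  let _ : MulAction P Z := MulAction.compHom Z ψ
  refine ⟨MulAction.orbit P x, (Set.countable_range _).to_subtype,
    MulAction.toPermHom P (MulAction.orbit P x), ?_, ?_, ?_⟩
  · rw [injective_iff_map_eq_one]
    intro p hp
    refine hfaith p fun q => ?_
    have := congrArg Subtype.val (Equiv.Perm.ext_iff.1 hp ⟨ψ q x, q, rfl⟩)
    exact this
  · exact fun y z => MulAction.exists_smul_eq P y z
  · refine ⟨fun S => ν (Subtype.val '' S) / ν (MulAction.orbit P x), fun S => ?_, ?_, ?_, ?_⟩
    · exact div_nonneg (hν.nonneg _) (hν.nonneg _)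
    · simp only [Set.image_univ, Subtype.range_coe]
      exact div_self hpos.ne'
    · intro S T hST
      beta_reduce
      rw [Set.image_union, hν.union _ _
        ((Set.disjoint_image_iff Subtype.val_injective).2 hST), add_div]
    · intro p S
      beta_reduce
      rw [← mem_preservingPerms.1 (hψ ⟨p, rfl⟩) (Subtype.val '' _)]
      congr 2
      ext z
      constructor
      · rintro ⟨_, ⟨w, hw, rfl⟩, hz⟩
        exact ⟨w, hw, (ψ p).injective hz⟩
      · rintro ⟨w, hw, rfl⟩
        exact ⟨_, ⟨w, hw, rfl⟩, rfl⟩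

theorem exists_equivariant_of_free {B Y : Type*} [Group B] (ρ : B →* Equiv.Perm Y)
    (hρ : ∀ b y, ρ b y = y → b = 1) : ∃ s : Y → B, ∀ b y, s (ρ b y) = b * s y := by
  let _ : MulAction B Y := MulAction.compHom Y ρ
  have rep : ∀ y : Y, ∃ b : B, ρ b (Quotient.mk (MulAction.orbitRel B Y) y).out = y := fun y =>
    MulAction.orbitRel_apply.1 ((MulAction.orbitRel B Y).symm (Quotient.mk_out (s := MulAction.orbitRel B Y) y))
  choose s hs using rep
  refine ⟨s, fun b y => ?_⟩
  have hcls : Quotient.mk (MulAction.orbitRel B Y) (ρ b y)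
      = Quotient.mk (MulAction.orbitRel B Y) y :=
    Quotient.sound (MulAction.orbitRel_apply.2 ⟨b, rfl⟩)
  have h1 := hs (ρ b y)
  rw [hcls] at h1
  have h2 : ρ ((b * s y)⁻¹ * s (ρ b y)) (Quotient.mk (MulAction.orbitRel B Y) y).out
      = (Quotient.mk (MulAction.orbitRel B Y) y).out := by
    rw [map_mul, map_inv, Equiv.Perm.mul_apply, h1, Equiv.Perm.inv_eq_iff_eq, map_mul,
      Equiv.Perm.mul_apply, hs]
  exact (inv_mul_eq_one.1 (hρ _ _ h2)).symm

/-- The involution of `X × Y` exchanging the `A`-coordinates of the two factors, where the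
equivariant maps `s` and `t` read off these coordinates. -/
def exchange {A X Y : Type*} [Group A] (α : A →* Equiv.Perm X) (β : A →* Equiv.Perm Y)
    {s : X → A} {t : Y → A} (hs : ∀ a x, s (α a x) = a * s x)
    (ht : ∀ a y, t (β a y) = a * t y) : Equiv.Perm (X × Y) :=
  Involutive.toPerm
    (fun p => (α (t p.2 * (s p.1)⁻¹) p.1, β (s p.1 * (t p.2)⁻¹) p.2)) <| by
    rintro ⟨x, y⟩
    simp only [hs, ht, inv_mul_cancel_right, ← Equiv.Perm.mul_apply, ← map_mul]
    simp

/-- The homomorphism letting a group act on the second factor only. -/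
def sndPerm {B Y : Type*} [Group B] (X : Type*) (ρ : B →* Equiv.Perm Y) :
    B →* Equiv.Perm (X × Y) where
  toFun b := Equiv.prodCongr (Equiv.refl X) (ρ b)
  map_one' := by ext <;> simp
  map_mul' a b := by ext <;> simp

/-- The homomorphism letting a group act on the first factor only. -/
def fstPerm {B X : Type*} [Group B] (Y : Type*) (ρ : B →* Equiv.Perm X) :
    B →* Equiv.Perm (X × Y) where
  toFun b := Equiv.prodCongr (ρ b) (Equiv.refl Y)
  map_one' := by ext <;> simp
  map_mul' a b := by ext <;> simp

@[simp]
theorem sndPerm_apply {B Y : Type*} [Group B] (X : Type*) (ρ : B →* Equiv.Perm Y) (b : B)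
    (p : X × Y) : sndPerm X ρ b p = (p.1, ρ b p.2) := rfl

@[simp]
theorem fstPerm_apply {B X : Type*} [Group B] (Y : Type*) (ρ : B →* Equiv.Perm X) (b : B)
    (p : X × Y) : fstPerm Y ρ b p = (ρ b p.1, p.2) := rfl

section exchange

variable {A X Y : Type*} [Group A] (α : A →* Equiv.Perm X) (β : A →* Equiv.Perm Y)
    {s : X → A} {t : Y → A} (hs : ∀ a x, s (α a x) = a * s x)
    (ht : ∀ a y, t (β a y) = a * t y)

theorem exchange_apply (p : X × Y) : exchange α β hs ht p =
    (α (t p.2 * (s p.1)⁻¹) p.1, β (s p.1 * (t p.2)⁻¹) p.2) := rfl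

theorem exchange_mul_self : exchange α β hs ht * exchange α β hs ht = 1 :=
  Equiv.ext fun p => (exchange α β hs ht).symm_apply_apply p

theorem exchange_inv : (exchange α β hs ht)⁻¹ = exchange α β hs ht :=
  inv_eq_of_mul_eq_one_left (exchange_mul_self α β hs ht)

/-- Conjugation by the exchange turns the action on the second factor into the action on the
first factor. -/
theorem exchange_conj (a : A) : exchange α β hs ht * sndPerm X β a * (exchange α β hs ht)⁻¹
    = fstPerm Y α a := by
  rw [mul_inv_eq_iff_eq_mul]
  ext1 ⟨x, y⟩
  simp only [Equiv.Perm.mul_apply, exchange_apply, sndPerm_apply, fstPerm_apply, ht,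
    mul_inv_rev, mul_assoc, map_mul]
  simp

end exchange

namespace IsAmalgamatedProduct

variable {A G H P : Type} [Group A] [Group G] [Group H] [Group P]
    {iG : A →* G} {iH : A →* H} {jG : G →* P} {jH : H →* P}

theorem eq_top (hP : IsAmalgamatedProduct iG iH jG jH) (K : Subgroup P) (hG : jG.range ≤ K)
    (hH : jH.range ≤ K) : K = ⊤ := by
  have hG' : ∀ g, jG g ∈ K := fun g => hG ⟨g, rfl⟩
  have hH' : ∀ h, jH h ∈ K := fun h => hH ⟨h, rfl⟩
  obtain ⟨f, ⟨hf1, hf2⟩, -⟩ := hP.2 K (jG.codRestrict K hG') (jH.codRestrict K hH') (by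
    ext a
    exact DFunLike.congr_fun hP.1 a)
  obtain ⟨u, -, hu⟩ := hP.2 P jG jH hP.1
  have h1 : K.subtype.comp f = MonoidHom.id P := by
    rw [hu (K.subtype.comp f), hu (MonoidHom.id P)]
    · exact ⟨rfl, rfl⟩
    · beta_reduce
      rw [MonoidHom.comp_assoc, MonoidHom.comp_assoc, hf1, hf2]
      exact ⟨rfl, rfl⟩
  refine (Subgroup.eq_top_iff' K).2 fun p => ?_
  rw [← MonoidHom.id_apply P p, ← h1]
  exact (f p).2

theorem range_le (hP : IsAmalgamatedProduct iG iH jG jH) {L : Type*} [Group L] (f : P →* L)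
    (K : Subgroup L) (hG : ∀ g, f (jG g) ∈ K) (hH : ∀ h, f (jH h) ∈ K) : f.range ≤ K := by
  rintro _ ⟨p, rfl⟩
  have := hP.eq_top (K.comap f) (by rintro _ ⟨g, rfl⟩; exact hG g)
    (by rintro _ ⟨h, rfl⟩; exact hH h)
  have hp : p ∈ K.comap f := this ▸ Subgroup.mem_top p
  exact hp

theorem countable [Countable G] [Countable H] (hP : IsAmalgamatedProduct iG iH jG jH) :
    Countable P := by
  have hcF : Countable (FreeGroup (G ⊕ H)) := inferInstanceAs (Countable (Quot _))
  have htop := hP.eq_top (FreeGroup.lift (Sum.elim jG jH)).range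
    (by rintro _ ⟨g, rfl⟩; exact ⟨FreeGroup.of (Sum.inl g), by simp⟩)
    (by rintro _ ⟨h, rfl⟩; exact ⟨FreeGroup.of (Sum.inr h), by simp⟩)
  exact (MonoidHom.range_eq_top.1 htop).countable

/-- Both factors embed into the amalgamated product. -/
theorem injective (hP : IsAmalgamatedProduct iG iH jG jH) (hiG : Injective iG)
    (hiH : Injective iH) : Injective jG ∧ Injective jH := by
  let lG := MulAction.toPermHom G G
  let lH := MulAction.toPermHom H H
  obtain ⟨s, hs⟩ := exists_equivariant_of_free (lG.comp iG) fun a g h =>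
    (injective_iff_map_eq_one iG).1 hiG a (mul_eq_right.1 h)
  obtain ⟨t, ht⟩ := exists_equivariant_of_free (lH.comp iH) fun a g h =>
    (injective_iff_map_eq_one iH).1 hiH a (mul_eq_right.1 h)
  let Φ := exchange _ _ hs ht
  obtain ⟨f, ⟨hf1, hf2⟩, -⟩ := hP.2 (Equiv.Perm (G × H)) (fstPerm H lG)
    ((MulAut.conj Φ).toMonoidHom.comp (sndPerm G lH))
    (MonoidHom.ext fun a => (exchange_conj _ _ hs ht a).symm)
  constructor
  · refine Injective.of_comp (f := f) ?_
    have : Injective (fstPerm H lG) := (injective_iff_map_eq_one _).2 fun g hg => by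
      have := congrArg Prod.fst (Equiv.Perm.ext_iff.1 hg (1, 1))
      simpa [lG] using this
    rwa [← hf1] at this
  · refine Injective.of_comp (f := f) ?_
    have : Injective (sndPerm G lH) := (injective_iff_map_eq_one _).2 fun g hg => by
      have := congrArg Prod.snd (Equiv.Perm.ext_iff.1 hg (1, 1))
      simpa [lH] using this
    have h2 := (MulAut.conj Φ).injective.comp this
    rw [← MonoidHom.coe_comp, hf2]
    exact h2

end IsAmalgamatedProduct

/-- The product of `m` with the counting function of `Q`, extended by zero to `G × Q ⊕ Y`. -/
def prodCount {X : Type*} (m : Set X → ℝ) (Q Y : Type*) [Fintype Q] (S : Set (X × Q ⊕ Y)) : ℝ :=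
  ∑ q, m {x | Sum.inl (x, q) ∈ S}

section prodCount

variable {X Q Y : Type*} [Fintype Q] {m : Set X → ℝ}

theorem IsFinAdditive.prodCount (hm : IsFinAdditive m) : IsFinAdditive (prodCount m Q Y) where
  nonneg S := Finset.sum_nonneg fun _ _ => hm.nonneg _
  union S T h := by
    simp only [_root_.prodCount, ← Finset.sum_add_distrib]
    refine Finset.sum_congr rfl fun q _ => ?_
    rw [← hm.union]
    · rfl
    · exact Set.disjoint_left.2 fun x hx hx' => Set.disjoint_left.1 h hx hx'

theorem IsFinAdditive.prodCount_singleton (hm : IsFinAdditive m) (h : ∀ x, m {x} = 0)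
    (z : X × Q ⊕ Y) : _root_.prodCount m Q Y {z} = 0 := by
  refine Finset.sum_eq_zero fun q _ => hm.finite_eq_zero h ?_
  exact (Set.finite_singleton z).preimage fun x _ y _ hxy => by simpa using hxy

theorem sumCongrHom_mem_preservingPerms {θ : Equiv.Perm (X × Q)} (π : Equiv.Perm Y)
    (hθ : ∀ T : Set (X × Q), ∑ q, m {x | θ (x, q) ∈ T} = ∑ q, m {x | (x, q) ∈ T}) :
    Equiv.Perm.sumCongrHom _ _ (θ, π) ∈ preservingPerms (prodCount m Q Y) := fun S =>
  hθ {p | Sum.inl p ∈ S}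

theorem fstPerm_mem_preservingPerms {B : Type*} [Group B] {ρ : B →* Equiv.Perm X} {b : B}
    (hb : ρ b ∈ preservingPerms m) (π : Equiv.Perm Y) :
    Equiv.Perm.sumCongrHom _ _ (fstPerm Q ρ b, π) ∈ preservingPerms (prodCount m Q Y) :=
  sumCongrHom_mem_preservingPerms π fun T =>
    Finset.sum_congr rfl fun q _ => hb {x | (x, q) ∈ T}

theorem sndPerm_mem_preservingPerms {B : Type*} [Group B] (ρ : B →* Equiv.Perm Q) (b : B)
    (π : Equiv.Perm Y) :
    Equiv.Perm.sumCongrHom _ _ (sndPerm X ρ b, π) ∈ preservingPerms (prodCount m Q Y) :=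
  sumCongrHom_mem_preservingPerms π fun T => Equiv.sum_comp (ρ b) fun q => m {x | (x, q) ∈ T}

theorem exchange_mem_preservingPerms {A : Type*} [Group A] [Fintype A] (hm : IsFinAdditive m)
    {α : A →* Equiv.Perm X} (β : A →* Equiv.Perm Q) {s : X → A} {t : Q → A}
    (hs : ∀ a x, s (α a x) = a * s x) (ht : ∀ a y, t (β a y) = a * t y)
    (hα : ∀ a, α a ∈ preservingPerms m) (π : Equiv.Perm Y) :
    Equiv.Perm.sumCongrHom _ _ (exchange α β hs ht, π) ∈ preservingPerms (prodCount m Q Y) := by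
  refine sumCongrHom_mem_preservingPerms π fun T => ?_
  have key : ∀ a q, m {x | s x = a ∧ exchange α β hs ht (x, q) ∈ T} =
      m {x | s x = t q ∧ (x, β (a * (t q)⁻¹) q) ∈ T} := fun a q => by
    rw [← hα (t q * a⁻¹) {x | s x = t q ∧ (x, β (a * (t q)⁻¹) q) ∈ T}]
    congr 1
    ext x
    simp only [Set.mem_preimage, Set.mem_ofPred_eq, hs, exchange_apply, mul_assoc,
      mul_eq_left, inv_mul_eq_one]
    constructor <;> rintro ⟨rfl, h⟩ <;> exact ⟨rfl, h⟩
  have lhs : ∀ q, m {x | exchange α β hs ht (x, q) ∈ T} =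
      ∑ a, m {x | s x = a ∧ exchange α β hs ht (x, q) ∈ T} := fun q => hm.eq_sum_fiber s _
  have rhs : ∀ q, m {x | (x, q) ∈ T} = ∑ a, m {x | s x = a ∧ (x, q) ∈ T} :=
    fun q => hm.eq_sum_fiber s _
  simp only [lhs, rhs, key]
  rw [← Fintype.sum_prod_type' (f := fun q a => m {x | s x = t q ∧ (x, β (a * (t q)⁻¹) q) ∈ T}),
    ← Fintype.sum_prod_type' (f := fun q a => m {x | s x = a ∧ (x, q) ∈ T})]
  let ε : Q × A → Q × A := fun p => (β (p.2 * (t p.1)⁻¹) p.1, t p.1)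
  have hε : Involutive ε := fun ⟨q, a⟩ => by
    simp only [ε, ht, inv_mul_cancel_right, ← Equiv.Perm.mul_apply, ← map_mul]
    simp
  exact Equiv.sum_comp (hε.toPerm ε) fun p => m {x | s x = p.2 ∧ (x, p.1) ∈ T}

end prodCount

/-- The permutation of `U ⊕ V` swapping a copy of `A` in `U` with a copy of `A` in `V`. -/
noncomputable def swapCopies {A U V : Type*} {u : A → U} {v : A → V} (hu : Injective u)
    (hv : Injective v) : Equiv.Perm (U ⊕ V) :=
  Involutive.toPerm (Sum.elim (extend u (Sum.inr ∘ v) Sum.inl) (extend v (Sum.inl ∘ u) Sum.inr))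
    (by
      rintro (x | y)
      · by_cases hx : ∃ a, u a = x
        · obtain ⟨a, rfl⟩ := hx
          simp [hu.extend_apply, hv.extend_apply]
        · simp [extend_apply' _ _ _ hx]
      · by_cases hy : ∃ a, v a = y
        · obtain ⟨a, rfl⟩ := hy
          simp [hu.extend_apply, hv.extend_apply]
        · simp [extend_apply' _ _ _ hy])

section swapCopies

variable {A U V : Type*} {u : A → U} {v : A → V} (hu : Injective u) (hv : Injective v)

theorem swapCopies_inl (a : A) : swapCopies hu hv (Sum.inl (u a)) = Sum.inr (v a) :=
  hu.extend_apply _ _ a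

theorem swapCopies_inr (a : A) : swapCopies hu hv (Sum.inr (v a)) = Sum.inl (u a) :=
  hv.extend_apply _ _ a

theorem swapCopies_inl_of_notMem {x : U} (hx : ¬∃ a, u a = x) :
    swapCopies hu hv (Sum.inl x) = Sum.inl x :=
  extend_apply' _ _ _ hx

theorem swapCopies_inr_of_notMem {y : V} (hy : ¬∃ a, v a = y) :
    swapCopies hu hv (Sum.inr y) = Sum.inr y :=
  extend_apply' _ _ _ hy

theorem swapCopies_inv : (swapCopies hu hv)⁻¹ = swapCopies hu hv :=
  rfl

theorem swapCopies_support_finite [Finite A] : {z | swapCopies hu hv z ≠ z}.Finite := by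
  refine ((Set.finite_range (Sum.inl ∘ u)).union (Set.finite_range (Sum.inr ∘ v))).subset ?_
  rintro (x | y) hz
  · by_cases hx : ∃ a, u a = x
    · obtain ⟨a, rfl⟩ := hx
      exact Or.inl ⟨a, rfl⟩
    · exact absurd (swapCopies_inl_of_notMem hu hv hx) hz
  · by_cases hy : ∃ a, v a = y
    · obtain ⟨a, rfl⟩ := hy
      exact Or.inr ⟨a, rfl⟩
    · exact absurd (swapCopies_inr_of_notMem hu hv hy) hz

theorem swapCopies_conj [Group A] {a : A} {κ : Equiv.Perm U} {l : Equiv.Perm V}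
    (hκ : ∀ b, κ (u b) = u (a * b)) (hl : ∀ b, l (v b) = v (a * b)) :
    swapCopies hu hv * Equiv.Perm.sumCongrHom _ _ (κ, l) * (swapCopies hu hv)⁻¹ =
      Equiv.Perm.sumCongrHom _ _ (κ, l) := by
  have hκ' : ∀ x, (¬∃ b, u b = x) → ¬∃ b, u b = κ x := by
    rintro x hx ⟨b, hb⟩
    exact hx ⟨a⁻¹ * b, κ.injective (by rw [hκ, mul_inv_cancel_left, hb])⟩
  have hl' : ∀ y, (¬∃ b, v b = y) → ¬∃ b, v b = l y := by
    rintro x hx ⟨b, hb⟩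
    exact hx ⟨a⁻¹ * b, l.injective (by rw [hl, mul_inv_cancel_left, hb])⟩
  rw [mul_inv_eq_iff_eq_mul]
  ext1 z
  simp only [Equiv.Perm.mul_apply, Equiv.Perm.sumCongrHom_apply]
  rcases z with x | y
  · by_cases hx : ∃ b, u b = x
    · obtain ⟨b, rfl⟩ := hx
      simp [hκ, hl, swapCopies_inl]
    · simp [swapCopies_inl_of_notMem hu hv hx, swapCopies_inl_of_notMem hu hv (hκ' x hx)]
  · by_cases hy : ∃ b, v b = y
    · obtain ⟨b, rfl⟩ := hy
      simp [hκ, hl, swapCopies_inr]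
    · simp [swapCopies_inr_of_notMem hu hv hy, swapCopies_inr_of_notMem hu hv (hl' y hy)]

end swapCopies

/-- The elements of `P` acting on almost all of `P ⊆ U ⊕ P` as left translation form a
subgroup. -/
theorem cofinite_translation {U P : Type*} [Group P] (ψ : P →* Equiv.Perm (U ⊕ P)) :
    ∃ K : Subgroup P, ∀ p, p ∈ K ↔ {y | ψ p (Sum.inr y) ≠ Sum.inr (p * y)}.Finite := by
  refine ⟨⟨⟨⟨{p | {y | ψ p (Sum.inr y) ≠ Sum.inr (p * y)}.Finite}, ?_⟩, ?_⟩, ?_⟩,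
    fun _ => Iff.rfl⟩
  · intro a b ha hb
    refine (hb.union (ha.preimage (mul_right_injective b).injOn)).subset fun y hy => ?_
    by_contra h
    simp only [Set.mem_union, Set.mem_preimage, Set.mem_ofPred_eq, not_or, not_not] at h
    exact hy (by rw [map_mul, Equiv.Perm.mul_apply, h.1, h.2, mul_assoc])
  · simp
  · intro a ha
    refine (ha.preimage (mul_right_injective a⁻¹).injOn).subset fun y hy => ?_
    by_contra h
    simp only [Set.mem_preimage, Set.mem_ofPred_eq, not_not, mul_inv_cancel_left] at h
    exact hy (by rw [map_inv, Equiv.Perm.inv_eq_iff_eq, h])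

theorem IsInvariantMean.isFinAdditive {G X : Type*} [Group G] {φ : G →* Equiv.Perm X}
    {μ : Set X → ℝ} (hμ : IsInvariantMean φ μ) : IsFinAdditive μ :=
  ⟨hμ.1, hμ.2.2.1⟩

theorem IsInvariantMean.mem_preservingPerms {G X : Type*} [Group G] {φ : G →* Equiv.Perm X}
    {μ : Set X → ℝ} (hμ : IsInvariantMean φ μ) (g : G) : φ g ∈ preservingPerms μ := fun S => by
  rw [← hμ.2.2.2 g, Set.image_preimage_eq _ (φ g).surjective]

/-- An invariant mean on an infinite group vanishes on points. -/
theorem IsInvariantMean.singleton_eq_zero {G : Type*} [Group G] [Infinite G] {μ : Set G → ℝ}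
    (hμ : IsInvariantMean (MulAction.toPermHom G G) μ) (g : G) : μ {g} = 0 := by
  have hconst : ∀ g, μ {g} = μ {1} := fun g => by
    have := hμ.2.2.2 g {1}
    simpa using this
  have hbound : ∀ n : ℕ, n * μ {1} ≤ 1 := fun n => by
    obtain ⟨s, rfl⟩ := Infinite.exists_subset_card_eq G n
    have := hμ.isFinAdditive.biUnion s (fun g => {g}) fun a b hab => by simpa [onFun] using hab
    simp only [hconst, Finset.sum_const, nsmul_eq_mul] at this
    rw [← this, ← hμ.2.1]
    exact hμ.isFinAdditive.mono (Set.subset_univ _)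
  rw [hconst]
  by_contra h0
  have hpos : 0 < μ {1} := lt_of_le_of_ne (hμ.1 _) (Ne.symm h0)
  obtain ⟨n, hn⟩ := exists_nat_gt (1 / μ {1})
  rw [div_lt_iff₀ hpos] at hn
  linarith [hbound n]

/-- A group isomorphic to a countable amenable group is in the class `𝒜`. -/
theorem inClassA_of_mulEquiv {G P : Type} [Group G] [Group P] [Countable G]
    (hG : AmenableGroup G) (e : P ≃* G) : InClassA P := by
  obtain ⟨μ, h0, h1, h2, h3⟩ := hG
  refine ⟨G, inferInstance, (MulAction.toPermHom G G).comp e.toMonoidHom, ?_, ?_,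
    μ, h0, h1, h2, fun g S => h3 (e g) S⟩
  · rw [injective_iff_map_eq_one]
    intro p hp
    have := Equiv.Perm.ext_iff.1 hp 1
    simpa using this
  · exact fun x y => ⟨e.symm (y * x⁻¹), by simp⟩

namespace IsAmalgamatedProduct

variable {A G H P : Type} [Group A] [Group G] [Group H] [Group P]
    {iG : A →* G} {iH : A →* H} {jG : G →* P} {jH : H →* P}

theorem inClassA_of_surjective [Countable G] (hG : AmenableGroup G)
    (hP : IsAmalgamatedProduct iG iH jG jH) (hjG : Injective jG) (hiH : Surjective iH) :
    InClassA P := by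
  have htop : jG.range = ⊤ := hP.eq_top _ le_rfl (by
    rintro _ ⟨h, rfl⟩
    obtain ⟨a, rfl⟩ := hiH h
    exact ⟨iG a, DFunLike.congr_fun hP.1 a⟩)
  exact inClassA_of_mulEquiv hG
    (MulEquiv.ofBijective jG ⟨hjG, MonoidHom.range_eq_top.1 htop⟩).symm

/-- If `H` acts on a finite set `Q` such that `A` acts freely and `A ≠ H`, then the amalgamated
product acts on `G × Q ⊕ P`, with an orbit witnessing membership in the class `𝒜`. -/
theorem inClassA_of_finite_action [Countable G] [Countable H] [Finite A] [Infinite G]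
    (hG : AmenableGroup G) (hiG : Injective iG) (hiH : Injective iH)
    (hP : IsAmalgamatedProduct iG iH jG jH) {Q : Type} [Fintype Q] (ρ : H →* Equiv.Perm Q)
    (hρ : ∀ a q, ρ (iH a) q = q → a = 1) (q₀ : Q) {h₀ : H} (h_zero : h₀ ∉ iH.range) :
    InClassA P := by
  have := Fintype.ofFinite A
  have hcP := hP.countable
  obtain ⟨hjG, hjH⟩ := hP.injective hiG hiH
  have hj : ∀ a, jG (iG a) = jH (iH a) := DFunLike.congr_fun hP.1
  obtain ⟨m, hm⟩ := hG
  have hadd := hm.isFinAdditive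
  let lG := MulAction.toPermHom G G
  let lP := MulAction.toPermHom P P
  obtain ⟨s, hs⟩ := exists_equivariant_of_free (lG.comp iG) fun a g h =>
    (injective_iff_map_eq_one iG).1 hiG a (mul_eq_right.1 h)
  obtain ⟨t, ht⟩ := exists_equivariant_of_free (ρ.comp iH) hρ
  let c := Equiv.Perm.sumCongrHom (G × Q) P
  have hu : Injective fun a => (iG a, q₀) := fun a b hab => hiG (congrArg Prod.fst hab)
  have hv : Injective fun a => jH (iH a) := hjH.comp hiH
  let Φ := exchange _ _ hs ht
  let σ := swapCopies hu hv
  let fG : G →* Equiv.Perm (G × Q ⊕ P) := c.comp ((fstPerm Q lG).prod (lP.comp jG))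
  let fH : H →* Equiv.Perm (G × Q ⊕ P) := (MulAut.conj σ).toMonoidHom.comp
    ((MulAut.conj (c (Φ, 1))).toMonoidHom.comp (c.comp ((sndPerm G ρ).prod (lP.comp jH))))
  have hfH : ∀ h, fH h = σ * c (Φ * sndPerm G ρ h * Φ⁻¹, lP (jH h)) * σ⁻¹ := fun h => by
    change σ * (c (Φ, 1) * c (sndPerm G ρ h, lP (jH h)) * (c (Φ, 1))⁻¹) * σ⁻¹ = _
    rw [← map_inv, ← map_mul, ← map_mul]
    simp
  obtain ⟨ψ, ⟨hψG, hψH⟩, -⟩ := hP.2 _ fG fH (MonoidHom.ext fun a => by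
    change fG (iG a) = fH (iH a)
    rw [hfH]
    have h1 : Φ * sndPerm G ρ (iH a) * Φ⁻¹ = fstPerm Q lG (iG a) := exchange_conj _ _ hs ht a
    have h2 := swapCopies_conj hu hv (a := a) (κ := fstPerm Q lG (iG a)) (l := lP (jH (iH a)))
      (fun b => by simp [lG]) (fun b => by simp [lP])
    rw [h1, h2, ← hj]
    rfl)
  replace hψG : ∀ g, ψ (jG g) = fG g := DFunLike.congr_fun hψG
  replace hψH : ∀ h, ψ (jH h) = fH h := DFunLike.congr_fun hψH
  have hpres : ψ.range ≤ preservingPerms (prodCount m Q P) := by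
    refine hP.range_le ψ _ (fun g => ?_) (fun h => ?_)
    · rw [hψG]
      exact fstPerm_mem_preservingPerms (hm.mem_preservingPerms g) _
    · have hσ : σ ∈ preservingPerms (prodCount m Q P) :=
        hadd.prodCount.mem_preservingPerms_of_finite
          (hadd.prodCount_singleton hm.singleton_eq_zero) (swapCopies_support_finite hu hv)
      have hΦ : c (Φ, 1) ∈ preservingPerms (prodCount m Q P) :=
        exchange_mem_preservingPerms hadd _ hs ht (fun a => hm.mem_preservingPerms (iG a)) 1
      rw [hψH]
      exact mul_mem (mul_mem hσ (mul_mem (mul_mem hΦ (sndPerm_mem_preservingPerms ρ h _))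
        (inv_mem hΦ))) (inv_mem hσ)
  have hψG_inl : ∀ g x q, ψ (jG g) (Sum.inl (x, q)) = Sum.inl (g * x, q) := fun g x q => by
    rw [hψG]
    rfl
  have hψG_inr : ∀ g y, ψ (jG g) (Sum.inr y) = Sum.inr (jG g * y) := fun g y => by
    rw [hψG]
    rfl
  have hψH_inr : ∀ h y, (¬∃ a, jH (iH a) = y) → (¬∃ a, jH (iH a) = jH h * y) →
      ψ (jH h) (Sum.inr y) = Sum.inr (jH h * y) := fun h y h1 h2 => by
    rw [hψH, hfH, Equiv.Perm.mul_apply, Equiv.Perm.mul_apply, swapCopies_inv,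
      swapCopies_inr_of_notMem hu hv h1]
    exact swapCopies_inr_of_notMem hu hv h2
  have hψH_base : ψ (jH h₀) (Sum.inl (1, q₀)) = Sum.inr (jH h₀) := by
    have h1 : σ (Sum.inl (1, q₀)) = Sum.inr 1 := by
      simpa using swapCopies_inl hu hv 1
    have h2 : ¬∃ a, jH (iH a) = jH h₀ * 1 := by
      rintro ⟨a, ha⟩
      exact h_zero ⟨a, hjH (by rw [ha, mul_one])⟩
    rw [hψH, hfH, Equiv.Perm.mul_apply, Equiv.Perm.mul_apply, swapCopies_inv, h1]
    exact (swapCopies_inr_of_notMem hu hv h2).trans (by rw [mul_one])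
  obtain ⟨K, hK⟩ := cofinite_translation ψ
  have hKtop : K = ⊤ := by
    refine hP.eq_top K ?_ ?_
    · rintro _ ⟨g, rfl⟩
      simp [hK, hψG_inr]
    · rintro _ ⟨h, rfl⟩
      rw [hK]
      have hfin := Set.finite_range fun a => jH (iH a)
      refine (hfin.union (hfin.preimage (mul_right_injective (jH h)).injOn)).subset fun y hy => ?_
      by_contra hcon
      rw [Set.mem_union, not_or] at hcon
      exact hy (hψH_inr h y hcon.1 hcon.2)
  refine inClassA_of_orbit ψ hadd.prodCount hpres (Sum.inl (1, q₀)) ?_ fun p hp => ?_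
  · have hle : m Set.univ ≤ prodCount m Q P (Set.range fun p => ψ p (Sum.inl (1, q₀))) := by
      refine le_trans (hadd.mono fun g _ => ?_)
        (Finset.single_le_sum (fun q _ => hadd.nonneg _) (Finset.mem_univ q₀))
      exact ⟨jG g, by simp [hψG_inl]⟩
    rw [hm.2.1] at hle
    linarith
  · have hfin := (hK p).1 (hKtop ▸ Subgroup.mem_top p)
    have hinf : (Set.range fun g => jG g * jH h₀).Infinite :=
      Set.infinite_range_of_injective ((mul_left_injective _).comp hjG)
    obtain ⟨_, ⟨g, rfl⟩, hg⟩ := (hinf.sdiff hfin).nonempty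
    have h1 := not_not.1 hg
    have h2 := hp (jG g * jH h₀)
    rw [map_mul, Equiv.Perm.mul_apply, hψH_base, hψG_inr, h1] at h2
    simpa using h2

end IsAmalgamatedProduct

/-- Corollary 2.10 (Moon, arXiv:1003.3998).
Let `G` be an infinite countable amenable group, `H` a countable group, and `A` a common
finite subgroup of `G` and `H` (given by injective homomorphisms `iG`, `iH`). If `H` has a
finite index normal subgroup `N` with `N ∩ A = {1}`, then `G ∗_A H` is in the class `𝒜`. -/
theorem amalgam_with_virtually_trivial_intersection_mem_classA
    (G H A : Type) [Group G] [Group H] [Group A]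
    [Countable G] [Countable H] [Finite A] [Infinite G]
    (hG : AmenableGroup G)
    (iG : A →* G) (iH : A →* H)
    (hiG : Function.Injective iG) (hiH : Function.Injective iH)
    (N : Subgroup H) (hN : N.Normal) (hNfin : N.FiniteIndex)
    (hNA : ∀ a : A, iH a ∈ N → a = 1)
    (P : Type) [Group P] (jG : G →* P) (jH : H →* P)
    (hP : IsAmalgamatedProduct iG iH jG jH) :
    InClassA P := by
  by_cases hsurj : Function.Surjective iH
  · exact hP.inClassA_of_surjective hG (hP.injective hiG hiH).1 hsurj
  · obtain ⟨h₀, h_zero⟩ := not_forall.1 hsurj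
    have := N.fintypeQuotientOfFiniteIndex
    refine hP.inClassA_of_finite_action hG hiG hiH (MulAction.toPermHom H (H ⧸ N))
      (fun a q => ?_) (1 : H) h_zero
    induction q using QuotientGroup.induction_on with
    | H x =>
      intro h
      refine hNA a ?_
      have h1 : ((iH a * x : H) : H ⧸ N) = x := h
      have h2 := hN.conj_mem _ (QuotientGroup.eq.1 h1.symm) x
      simpa using h2
end

section
/- Let G and H be infinite countable amenable groups. Then there exist Følner sequences {C_n}_{n≥1} of G and {D_n}_{n≥1} of H such that |C_n| = |D_n| for all n ≥ 1. -/
/-- A Følner sequence for the action of `G` on `X` given by `φ`: a sequence of finite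
non-empty subsets `C n` of `X` with `|C n △ g • C n| / |C n| → 0` for every `g : G`. -/
def IsFolnerSeq {G X : Type*} [Group G] (φ : G →* Equiv.Perm X) (C : ℕ → Set X) : Prop :=
  (∀ n, (C n).Finite ∧ (C n).Nonempty) ∧
  ∀ g : G, Filter.Tendsto
    (fun n => ((symmDiff (C n) ((φ g) '' C n)).ncard : ℝ) / ((C n).ncard : ℝ))
    Filter.atTop (nhds 0)

/-- A mean is additive over finite pairwise disjoint unions. -/
theorem IsInvariantMean.biUnion_eq_sum {G X ι : Type*} [Group G] {φ : G →* Equiv.Perm X}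
    {μ : Set X → ℝ} (hμ : IsInvariantMean φ μ) (K : Finset ι) (A : ι → Set X)
    (hA : Pairwise fun i j => Disjoint (A i) (A j)) :
    μ (⋃ i ∈ K, A i) = ∑ i ∈ K, μ (A i) := by
  classical
  obtain ⟨-, -, hadd, -⟩ := hμ
  induction K using Finset.induction_on with
  | empty =>
    have h := hadd ∅ ∅ (by simp)
    simp only [Set.union_empty] at h
    simp only [Finset.notMem_empty, Set.iUnion_of_empty, Set.iUnion_empty, Finset.sum_empty]
    linarith
  | insert a s ha ih =>
    rw [Finset.set_biUnion_insert, hadd, ih, Finset.sum_insert ha]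
    simp only [Set.disjoint_iUnion_right]
    exact fun i hi => hA fun h => ha (h ▸ hi)

/-- The range of an injective map which moves each point by one of finitely many group elements
has full mean. -/
theorem IsInvariantMean.range_eq_one {G X : Type*} [Group G] {φ : G →* Equiv.Perm X}
    {μ : Set X → ℝ} (hμ : IsInvariantMean φ μ) {f : X → X} (hf : Function.Injective f)
    (K : Finset G) (k : X → G) (hk : ∀ x, k x ∈ K) (hfk : ∀ x, φ (k x) x = f x) :
    μ (Set.range f) = 1 := by
  have hdisj : Pairwise fun i j => Disjoint (k ⁻¹' {i}) (k ⁻¹' {j}) := fun i j hij =>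
    Disjoint.preimage k (by simpa using hij)
  have huniv : (⋃ i ∈ K, k ⁻¹' {i}) = Set.univ := by
    ext x; simpa using hk x
  have himage (i : G) : f '' (k ⁻¹' {i}) = φ i '' (k ⁻¹' {i}) := by
    refine Set.image_congr fun x hx => ?_
    rw [← hfk x, show k x = i from hx]
  have hrange : Set.range f = ⋃ i ∈ K, f '' (k ⁻¹' {i}) := by
    rw [← Set.image_univ, ← huniv]
    simp only [Set.image_iUnion]
  rw [hrange, hμ.biUnion_eq_sum K _ fun i j hij =>
      (Set.disjoint_image_iff hf).2 (hdisj hij), ← hμ.2.1, ← huniv, hμ.biUnion_eq_sum K _ hdisj]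
  exact Finset.sum_congr rfl fun i _ => by rw [himage, hμ.2.2.2]

open scoped Pointwise in
/-- In an amenable group, no finite set multiplies all finite sets to at least twice their size. -/
theorem AmenableGroup.exists_card_mul_lt {G : Type*} [Group G] [DecidableEq G]
    (hG : AmenableGroup G) (K : Finset G) :
    ∃ F : Finset G, (K * F).card < 2 * F.card := by
  by_contra! h
  obtain ⟨μ, hμ⟩ := hG
  let t : G × Bool → Finset G := fun p => K * {p.1}
  have hall : ∀ s : Finset (G × Bool), s.card ≤ (s.biUnion t).card := by
    intro s
    have hs : s ⊆ s.image Prod.fst ×ˢ Finset.univ := fun p hp => by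
      simp only [Finset.mem_product, Finset.mem_univ, and_true]
      exact Finset.mem_image_of_mem _ hp
    have hKs : K * s.image Prod.fst ⊆ s.biUnion t := by
      intro x hx
      obtain ⟨a, ha, b, hb, rfl⟩ := Finset.mem_mul.1 hx
      obtain ⟨p, hp, rfl⟩ := Finset.mem_image.1 hb
      exact Finset.mem_biUnion.2 ⟨p, hp, Finset.mul_mem_mul ha (Finset.mem_singleton_self _)⟩
    have h1 := Finset.card_le_card hs
    rw [Finset.card_product, Finset.card_univ, Fintype.card_bool] at h1
    have h2 := h (s.image Prod.fst)
    have h3 := Finset.card_le_card hKs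
    omega
  obtain ⟨f, hf, hft⟩ := (Finset.all_card_le_biUnion_card_iff_exists_injective t).1 hall
  have hrange (b : Bool) : μ (Set.range fun g => f (g, b)) = 1 := by
    refine hμ.range_eq_one (fun x y hxy => congrArg Prod.fst (hf hxy)) K
      (fun g => f (g, b) * g⁻¹) (fun g => ?_) (fun g => by simp)
    obtain ⟨a, ha, c, hc, hac⟩ := Finset.mem_mul.1 (hft (g, b))
    rw [Finset.mem_singleton.1 hc] at hac
    simpa [← hac] using ha
  have hdisj : Disjoint (Set.range fun g => f (g, true)) (Set.range fun g => f (g, false)) := by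
    rw [Set.disjoint_iff_forall_ne]
    rintro _ ⟨x, rfl⟩ _ ⟨y, rfl⟩ hxy
    simpa using hf hxy
  obtain ⟨hnonneg, huniv, hadd, -⟩ := hμ
  have h1 := hadd _ _ hdisj
  have h2 := hadd _ _ (disjoint_compl_right
    (a := (Set.range fun g => f (g, true)) ∪ Set.range fun g => f (g, false)))
  rw [Set.union_compl_self, huniv, h1, hrange, hrange] at h2
  linarith [hnonneg ((Set.range fun g => f (g, true)) ∪ Set.range fun g => f (g, false))ᶜ]

open scoped Pointwise in
/-- Følner's condition for amenable groups. -/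
theorem AmenableGroup.exists_card_smul_sdiff_le {G : Type*} [Group G] [DecidableEq G]
    (hG : AmenableGroup G) (S : Finset G) {ε : ℝ} (hε : 0 < ε) :
    ∃ F : Finset G, F.Nonempty ∧ ∀ s ∈ S, ((s • F \ F).card : ℝ) ≤ ε * F.card := by
  by_contra! h
  have hgrow (F : Finset G) : (1 + ε) * F.card ≤ (insert 1 S * F).card := by
    rcases F.eq_empty_or_nonempty with rfl | hF
    · simp
    obtain ⟨s, hs, hlt⟩ := h F hF
    have hsub : F ∪ (s • F \ F) ⊆ insert 1 S * F := by
      refine Finset.union_subset (fun x hx => ?_) (Finset.sdiff_subset.trans ?_)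
      · exact Finset.mem_mul.2 ⟨1, Finset.mem_insert_self _ _, x, hx, one_mul x⟩
      · exact Finset.smul_finset_subset_mul (Finset.mem_insert_of_mem hs)
    have hcard := Finset.card_le_card hsub
    rw [Finset.card_union_of_disjoint Finset.disjoint_sdiff] at hcard
    have : (F.card : ℝ) + (s • F \ F).card ≤ (insert 1 S * F).card := mod_cast hcard
    linarith
  have hpow (n : ℕ) (F : Finset G) : (1 + ε) ^ n * F.card ≤ ((insert 1 S) ^ n * F).card := by
    induction n with
    | zero => simp
    | succ n ih =>
      rw [pow_succ', pow_succ', mul_assoc, mul_assoc]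
      exact (mul_le_mul_of_nonneg_left ih (by positivity)).trans (hgrow _)
  obtain ⟨n, hn⟩ := pow_unbounded_of_one_lt 2 (show 1 < 1 + ε by linarith)
  obtain ⟨F, hF⟩ := hG.exists_card_mul_lt ((insert 1 S) ^ n)
  have hF' : (((insert 1 S) ^ n * F).card : ℝ) < 2 * F.card := mod_cast hF
  have := mul_le_mul_of_nonneg_right hn.le (Nat.cast_nonneg (α := ℝ) F.card)
  linarith [hpow n F]

open scoped Pointwise in
/-- In an infinite group, a finite set has `n` pairwise disjoint right translates, whose union
is as invariant under left translations as the given set. -/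
theorem Finset.exists_card_eq_mul_card_smul_sdiff_le {G : Type*} [Group G] [Infinite G]
    [DecidableEq G] (F : Finset G) (n : ℕ) :
    ∃ E : Finset G, E.card = n * F.card ∧ ∀ g : G, (g • E \ E).card ≤ n * (g • F \ F).card := by
  induction n with
  | zero => exact ⟨∅, by simp⟩
  | succ n ih =>
    obtain ⟨E, hE, hEg⟩ := ih
    obtain ⟨x, hx⟩ := Infinite.exists_notMem_finset (F⁻¹ * E)
    have hdisj : Disjoint E (F * {x}) := by
      rw [Finset.disjoint_left]
      intro y hy hyF
      obtain ⟨a, ha, c, hc, rfl⟩ := Finset.mem_mul.1 hyF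
      rw [Finset.mem_singleton.1 hc] at hy
      exact hx (Finset.mem_mul.2 ⟨a⁻¹, Finset.inv_mem_inv ha, a * x, hy, by simp⟩)
    refine ⟨E ∪ F * {x}, ?_, fun g => ?_⟩
    · rw [Finset.card_union_of_disjoint hdisj, hE, Finset.card_mul_singleton, Nat.succ_mul]
    · have hsub : g • (E ∪ F * {x}) \ (E ∪ F * {x}) ⊆ (g • E \ E) ∪ (g • F \ F) * {x} := by
        intro y hy
        rw [Finset.smul_finset_union, ← smul_mul_assoc, Finset.mem_sdiff, Finset.mem_union,
          Finset.mem_union, not_or] at hy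
        obtain ⟨h | h, hyE, hyF⟩ := hy
        · exact Finset.mem_union_left _ (Finset.mem_sdiff.2 ⟨h, hyE⟩)
        · obtain ⟨a, ha, c, hc, rfl⟩ := Finset.mem_mul.1 h
          exact Finset.mem_union_right _ (Finset.mul_mem_mul
            (Finset.mem_sdiff.2 ⟨ha, fun haF => hyF (Finset.mul_mem_mul haF hc)⟩) hc)
      calc _ ≤ _ := Finset.card_le_card hsub
        _ ≤ _ := Finset.card_union_le _ _
        _ ≤ _ := by
          rw [Finset.card_mul_singleton, Nat.succ_mul]
          exact Nat.add_le_add_right (hEg g) _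

open scoped Pointwise in
/-- A sequence of finite sets whose `n`-th term is `ε n`-invariant under `S n` is a Følner
sequence, if the sets `S n` eventually contain each group element and `ε n` tends to `0`. -/
theorem isFolnerSeq_of_card_smul_sdiff_le {G : Type*} [Group G] [DecidableEq G]
    (C S : ℕ → Finset G) (ε : ℕ → ℝ) (hC : ∀ n, (C n).Nonempty)
    (hS : ∀ g, ∀ᶠ n in Filter.atTop, g ∈ S n) (hε : Filter.Tendsto ε Filter.atTop (nhds 0))
    (h : ∀ n, ∀ s ∈ S n, ((s • C n \ C n).card : ℝ) ≤ ε n * (C n).card) :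
    IsFolnerSeq (MulAction.toPermHom G G) fun n => (C n : Set G) := by
  refine ⟨fun n => ⟨(C n).finite_toSet, mod_cast hC n⟩, fun g => ?_⟩
  refine squeeze_zero' (g := fun n => 2 * ε n) (Filter.Eventually.of_forall fun n => by positivity)
    ?_ (by simpa using hε.const_mul 2)
  filter_upwards [hS g] with n hn
  have himage : (MulAction.toPermHom G G g) '' (C n : Set G) = ((g • C n : Finset G) : Set G) := by
    rw [Finset.coe_smul_finset]; rfl
  have hcomm : (C n \ g • C n).card = (g • C n \ C n).card :=
    Finset.card_sdiff_comm (Finset.card_smul_finset g (C n)).symm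
  have hle : (symmDiff (C n) (g • C n)).card ≤ 2 * (g • C n \ C n).card := by
    refine (Finset.card_union_le _ _).trans ?_
    omega
  have hle' : ((symmDiff (C n) (g • C n)).card : ℝ) ≤ 2 * (g • C n \ C n).card := mod_cast hle
  rw [himage, ← Finset.coe_symmDiff, Set.ncard_coe_finset, Set.ncard_coe_finset,
    div_le_iff₀ (mod_cast (hC n).card_pos)]
  linarith [h n g hn]

/-- A nonempty countable type is exhausted by a sequence of finite sets. -/
theorem exists_finset_seq_eventually_mem (α : Type*) [Countable α] [Nonempty α] :
    ∃ S : ℕ → Finset α, ∀ a, ∀ᶠ n in Filter.atTop, a ∈ S n := by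
  classical
  obtain ⟨e, he⟩ := exists_surjective_nat α
  refine ⟨fun n => (Finset.range (n + 1)).image e, fun a => ?_⟩
  obtain ⟨m, rfl⟩ := he a
  filter_upwards [Filter.eventually_ge_atTop m] with n hn
  exact Finset.mem_image_of_mem e (Finset.mem_range.2 (by omega))

open scoped Pointwise in
/-- Two infinite amenable groups have almost invariant finite sets of the same size. -/
theorem AmenableGroup.exists_card_eq_card_smul_sdiff_le {G H : Type*} [Group G] [Group H]
    [Infinite G] [Infinite H] [DecidableEq G] [DecidableEq H]
    (hG : AmenableGroup G) (hH : AmenableGroup H) (S : Finset G) (T : Finset H)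
    {ε : ℝ} (hε : 0 < ε) :
    ∃ (C : Finset G) (D : Finset H), C.Nonempty ∧ D.Nonempty ∧ C.card = D.card ∧
      (∀ s ∈ S, ((s • C \ C).card : ℝ) ≤ ε * C.card) ∧
      ∀ t ∈ T, ((t • D \ D).card : ℝ) ≤ ε * D.card := by
  obtain ⟨A, hA, hAS⟩ := hG.exists_card_smul_sdiff_le S hε
  obtain ⟨B, hB, hBT⟩ := hH.exists_card_smul_sdiff_le T hε
  obtain ⟨C, hC, hCA⟩ := A.exists_card_eq_mul_card_smul_sdiff_le B.card
  obtain ⟨D, hD, hDB⟩ := B.exists_card_eq_mul_card_smul_sdiff_le A.card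
  have hA' := hA.card_pos
  have hB' := hB.card_pos
  refine ⟨C, D, Finset.card_pos.1 (by rw [hC]; positivity),
    Finset.card_pos.1 (by rw [hD]; positivity), by rw [hC, hD, mul_comm],
    fun s hs => ?_, fun t ht => ?_⟩
  · calc ((s • C \ C).card : ℝ) ≤ B.card * (s • A \ A).card := mod_cast hCA s
      _ ≤ B.card * (ε * A.card) := by gcongr; exact hAS s hs
      _ = ε * C.card := by rw [hC]; push_cast; ring
  · calc ((t • D \ D).card : ℝ) ≤ A.card * (t • B \ B).card := mod_cast hDB t
      _ ≤ A.card * (ε * B.card) := by gcongr; exact hBT t ht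
      _ = ε * D.card := by rw [hD]; push_cast; ring


/-- Lemma 2.6 (Moon, arXiv:1003.3998).
Let `G` and `H` be infinite countable amenable groups. Then there exist Følner sequences
`{C n}` of `G` and `{D n}` of `H` such that `|C n| = |D n|` for all `n`. -/
theorem exists_folner_seqs_with_equal_card
    (G H : Type) [Group G] [Group H] [Countable G] [Countable H]
    [Infinite G] [Infinite H]
    (hG : AmenableGroup G) (hH : AmenableGroup H) :
    ∃ (C : ℕ → Set G) (D : ℕ → Set H),
      IsFolnerSeq (MulAction.toPermHom G G) C ∧
      IsFolnerSeq (MulAction.toPermHom H H) D ∧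
      ∀ n, (C n).ncard = (D n).ncard := by
  classical
  obtain ⟨S, hS⟩ := exists_finset_seq_eventually_mem G
  obtain ⟨T, hT⟩ := exists_finset_seq_eventually_mem H
  choose C D hC hD hcard hCS hDT using fun n : ℕ =>
    hG.exists_card_eq_card_smul_sdiff_le hH (S n) (T n) (Nat.one_div_pos_of_nat (α := ℝ) (n := n))
  have hε := tendsto_one_div_add_atTop_nhds_zero_nat (𝕜 := ℝ)
  exact ⟨_, _, isFolnerSeq_of_card_smul_sdiff_le C S _ hC hS hε hCS,
    isFolnerSeq_of_card_smul_sdiff_le D T _ hD hT hε hDT,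
    fun n => by simp [Set.ncard_coe_finset, hcard n]⟩
end

section
/- Let G and H be infinite countable amenable groups. Then for every ε > 0, every finite subset F ⊆ G, and every finite subset E ⊆ H, there exist a finite non-empty subset C' ⊆ G and a finite non-empty subset D' ⊆ H such that C' is (ε, F)-Følner, D' is (ε, E)-Følner, and |C'| = |D'|. -/
/-- A finite non-empty subset `C` of a group `G` is `(ε, F)`-Følner if
`|C △ gC| < ε * |C|` for every `g ∈ F`. -/
def IsFolnerSet {G : Type*} [Group G] (ε : ℝ) (F : Finset G) (C : Set G) : Prop :=
  C.Finite ∧ C.Nonempty ∧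
  ∀ g ∈ F, ((symmDiff C ((g * ·) '' C)).ncard : ℝ) < ε * (C.ncard : ℝ)

open scoped Pointwise

namespace IsInvariantMean

variable {G X : Type*} [Group G] {φ : G →* Equiv.Perm X} {μ : Set X → ℝ}

theorem map_empty (h : IsInvariantMean φ μ) : μ ∅ = 0 := by
  have := h.2.2.1 ∅ ∅ (Set.disjoint_empty _)
  simp only [Set.union_empty] at this
  linarith

theorem le_one (h : IsInvariantMean φ μ) (S : Set X) : μ S ≤ 1 := by
  have := h.2.2.1 S Sᶜ disjoint_compl_right
  rw [Set.union_compl_self, h.2.1] at this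
  linarith [h.1 Sᶜ]

theorem map_biUnion_finset (h : IsInvariantMean φ μ) {ι : Type*} (s : Finset ι) (A : ι → Set X)
    (hA : Pairwise (Function.onFun Disjoint A)) : μ (⋃ i ∈ s, A i) = ∑ i ∈ s, μ (A i) := by
  classical
  induction s using Finset.induction_on with
  | empty => simp [h.map_empty]
  | insert a s ha ih =>
    rw [Finset.set_biUnion_insert, Finset.sum_insert ha, h.2.2.1, ih]
    exact Set.disjoint_iUnion₂_right.2 fun i hi => hA (by rintro rfl; exact ha hi)

end IsInvariantMean

section

variable {G : Type*} [Group G]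

/-- An injective self-map of a group moving points by finitely many left translations has
range of full measure for every left-invariant mean. -/
theorem IsInvariantMean.range_eq_one_s9 {μ : Set G → ℝ}
    (h : IsInvariantMean (MulAction.toPermHom G G) μ) {f : G → G} (hf : Function.Injective f)
    (L : Finset G) (hL : ∀ x, ∃ k ∈ L, f x = k * x) : μ (Set.range f) = 1 := by
  let A : G → Set G := fun k => {x | f x = k * x}
  have hA : Pairwise (Function.onFun Disjoint A) := fun k l hkl =>
    Set.disjoint_left.2 fun x hk hl => hkl (mul_right_cancel (Eq.trans (Eq.symm hk) hl))
  have himage : ∀ k, MulAction.toPermHom G G k '' A k = f '' A k := fun k =>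
    Set.image_congr fun x hx => Eq.symm hx
  have hfA : Pairwise (Function.onFun Disjoint fun k => f '' A k) := fun k l hkl =>
    (Set.disjoint_image_iff hf).2 (hA hkl)
  have hU : ⋃ k ∈ L, A k = Set.univ := by
    ext x
    simpa [A] using hL x
  have hfU : ⋃ k ∈ L, f '' A k = Set.range f := by
    rw [← Set.image_univ, ← hU, Set.image_iUnion₂]
  rw [← hfU, h.map_biUnion_finset L _ hfA, ← h.2.1, ← hU, h.map_biUnion_finset L A hA]
  exact Finset.sum_congr rfl fun k _ => by rw [← himage, h.2.2.2]

open Classical in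
/-- In an amenable group no finite set doubles all finite sets. -/
theorem AmenableGroup.exists_card_mul_lt_s9 (hG : AmenableGroup G) (L : Finset G) :
    ∃ A : Finset G, (L * A).card < 2 * A.card := by
  obtain ⟨μ, hμ⟩ := hG
  by_contra! hL
  have hall : ∀ s : Finset (G × Bool), s.card ≤ (s.biUnion fun p => L * {p.1}).card := fun s => by
    have hs : s ⊆ s.image Prod.fst ×ˢ Finset.univ := fun p hp =>
      Finset.mem_product.2 ⟨Finset.mem_image_of_mem _ hp, Finset.mem_univ _⟩
    have hbi : s.biUnion (fun p => L * {p.1}) = L * s.image Prod.fst := by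
      ext x
      simp only [Finset.mem_biUnion, Finset.mem_mul, Finset.mem_singleton, Finset.mem_image]
      grind
    calc s.card ≤ (s.image Prod.fst ×ˢ (Finset.univ : Finset Bool)).card := Finset.card_le_card hs
      _ = 2 * (s.image Prod.fst).card := by simp [mul_comm]
      _ ≤ _ := by rw [hbi]; exact hL _
  obtain ⟨f, hf, hfL⟩ := (Finset.all_card_le_biUnion_card_iff_exists_injective _).1 hall
  have hrange : ∀ b, μ (Set.range fun x => f (x, b)) = 1 := fun b =>
    hμ.range_eq_one_s9 (fun x y hxy => (Prod.ext_iff.1 (hf hxy)).1) L fun x => by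
      obtain ⟨k, hk, y, hy, hkx⟩ := Finset.mem_mul.1 (hfL (x, b))
      exact ⟨k, hk, by rw [← hkx, Finset.mem_singleton.1 hy]⟩
  have hdisj : Disjoint (Set.range fun x => f (x, true)) (Set.range fun x => f (x, false)) := by
    rw [Set.disjoint_left]
    rintro _ ⟨x, rfl⟩ ⟨y, hy⟩
    exact absurd (hf hy) (by simp)
  have := hμ.2.2.1 _ _ hdisj
  rw [hrange, hrange] at this
  linarith [hμ.le_one ((Set.range fun x => f (x, true)) ∪ Set.range fun x => f (x, false))]

open Classical in
/-- If `A` fails the `(ε, F)`-Følner condition, then it grows under multiplication by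
`insert 1 F`. -/
theorem le_card_insert_one_mul_of_not_isFolnerSet {ε : ℝ} {F A : Finset G} (hA : A.Nonempty)
    (h : ¬ IsFolnerSet ε F (A : Set G)) :
    (1 + ε / 2) * A.card ≤ ((insert 1 F * A).card : ℝ) := by
  obtain ⟨g, hg, hgA⟩ : ∃ g ∈ F,
      ε * A.card ≤ ((symmDiff (A : Set G) ((g * ·) '' (A : Set G))).ncard : ℝ) := by
    by_contra! hlt
    exact h ⟨A.finite_toSet, by simpa using hA, by simpa using hlt⟩
  have himage : (g * ·) '' (A : Set G) = ((g • A : Finset G) : Set G) :=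
    (Finset.coe_smul_finset g A).symm
  rw [himage, ← Finset.coe_symmDiff, Set.ncard_coe_finset] at hgA
  have hcomm : (A \ g • A).card = (g • A \ A).card :=
    Finset.card_sdiff_comm (Finset.card_smul_finset g A).symm
  have hsymm : (symmDiff A (g • A)).card ≤ (A \ g • A).card + (g • A \ A).card :=
    Finset.card_union_le _ _
  have hsub : A ∪ g • A ⊆ insert 1 F * A := by
    refine Finset.union_subset (fun x hx => ?_) (fun x hx => ?_)
    · exact Finset.mem_mul.2 ⟨1, by simp, x, hx, one_mul x⟩
    · obtain ⟨y, hy, rfl⟩ := Finset.mem_smul_finset.1 hx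
      exact Finset.mul_mem_mul (Finset.mem_insert_of_mem hg) hy
  have hunion : A.card + (g • A \ A).card = (A ∪ g • A).card := by
    rw [add_comm, Finset.card_sdiff_add_card, Finset.union_comm]
  have hle := Finset.card_le_card hsub
  have h1 : ((symmDiff A (g • A)).card : ℝ) ≤ 2 * (g • A \ A).card := by
    exact_mod_cast (by omega : (symmDiff A (g • A)).card ≤ 2 * (g • A \ A).card)
  have h2 : (A.card : ℝ) + (g • A \ A).card ≤ (insert 1 F * A).card := by
    exact_mod_cast hunion.trans_le hle
  linarith

/-- Følner's theorem: an amenable group admits Følner sets. -/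
theorem AmenableGroup.exists_isFolnerSet (hG : AmenableGroup G) {ε : ℝ} (hε : 0 < ε)
    (F : Finset G) : ∃ C : Set G, IsFolnerSet ε F C := by
  classical
  by_contra! h
  have hgrow : ∀ (n : ℕ) (A : Finset G),
      (1 + ε / 2) ^ n * A.card ≤ (((insert 1 F) ^ n * A).card : ℝ) := fun n A => by
    rcases A.eq_empty_or_nonempty with rfl | hA
    · simp
    induction n with
    | zero => simp
    | succ n ih =>
      have hne : ((insert 1 F) ^ n * A).Nonempty := (Finset.insert_nonempty 1 F).pow.mul hA
      calc (1 + ε / 2) ^ (n + 1) * A.card = (1 + ε / 2) * ((1 + ε / 2) ^ n * A.card) := by ring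
        _ ≤ (1 + ε / 2) * (((insert 1 F) ^ n * A).card : ℝ) := by gcongr
        _ ≤ ((insert 1 F * ((insert 1 F) ^ n * A)).card : ℝ) :=
          le_card_insert_one_mul_of_not_isFolnerSet hne (h _)
        _ = _ := by rw [pow_succ', mul_assoc]
  obtain ⟨n, hn⟩ := pow_unbounded_of_one_lt 2 (by linarith : 1 < 1 + ε / 2)
  obtain ⟨A, hA⟩ := hG.exists_card_mul_lt_s9 ((insert 1 F) ^ n)
  have hA' : (((insert 1 F) ^ n * A).card : ℝ) < 2 * A.card := by exact_mod_cast hA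
  have : 2 * (A.card : ℝ) ≤ (1 + ε / 2) ^ n * A.card := by gcongr
  linarith [hgrow n A]

theorem IsFolnerSet.union {ε : ℝ} {F : Finset G} {A B : Set G} (hA : IsFolnerSet ε F A)
    (hB : IsFolnerSet ε F B) (hAB : Disjoint A B) : IsFolnerSet ε F (A ∪ B) := by
  refine ⟨hA.1.union hB.1, hA.2.1.inl, fun g hg => ?_⟩
  have hsub : symmDiff (A ∪ B) ((g * ·) '' (A ∪ B)) ⊆
      symmDiff A ((g * ·) '' A) ∪ symmDiff B ((g * ·) '' B) := by
    rw [Set.image_union]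
    intro x
    simp only [Set.mem_symmDiff, Set.mem_union]
    tauto
  have hfin : (symmDiff A ((g * ·) '' A) ∪ symmDiff B ((g * ·) '' B)).Finite :=
    (hA.1.symmDiff (hA.1.image _)).union (hB.1.symmDiff (hB.1.image _))
  have hle : ((symmDiff (A ∪ B) ((g * ·) '' (A ∪ B))).ncard : ℝ) ≤
      (symmDiff A ((g * ·) '' A)).ncard + (symmDiff B ((g * ·) '' B)).ncard := by
    exact_mod_cast (Set.ncard_le_ncard hsub hfin).trans (Set.ncard_union_le _ _)
  rw [Set.ncard_union_eq hAB hA.1 hB.1]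
  push_cast
  linarith [hA.2.2 g hg, hB.2.2 g hg]

theorem IsFolnerSet.image_mul_right {ε : ℝ} {F : Finset G} {C : Set G} (hC : IsFolnerSet ε F C)
    (h : G) : IsFolnerSet ε F ((· * h) '' C) := by
  refine ⟨hC.1.image _, hC.2.1.image _, fun g hg => ?_⟩
  have hinj : Function.Injective (· * h) := mul_left_injective h
  have hcomm : (g * ·) '' ((· * h) '' C) = (· * h) '' ((g * ·) '' C) := by
    simp only [Set.image_image, mul_assoc]
  rw [hcomm, ← Set.image_symmDiff hinj, Set.ncard_image_of_injective _ hinj,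
    Set.ncard_image_of_injective _ hinj]
  exact hC.2.2 g hg

/-- In an infinite group, a disjoint union of right translates of a Følner set is a Følner set
whose cardinality is any prescribed positive multiple of the original one. -/
theorem IsFolnerSet.exists_ncard_eq_mul [Infinite G] {ε : ℝ} {F : Finset G} {C : Set G}
    (hC : IsFolnerSet ε F C) {n : ℕ} (hn : 1 ≤ n) :
    ∃ C' : Set G, IsFolnerSet ε F C' ∧ C'.ncard = n * C.ncard := by
  induction n, hn using Nat.le_induction with
  | base => exact ⟨C, hC, (one_mul _).symm⟩
  | succ n _ ih =>
    obtain ⟨C', hC', hcard⟩ := ih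
    obtain ⟨h, hh⟩ := (hC.1.inv.mul hC'.1).exists_notMem
    have hdisj : Disjoint C' ((· * h) '' C) := by
      rw [Set.disjoint_left]
      rintro _ hx ⟨c, hc, rfl⟩
      exact hh ⟨c⁻¹, Set.inv_mem_inv.2 hc, c * h, hx, inv_mul_cancel_left c h⟩
    refine ⟨C' ∪ (· * h) '' C, hC'.union (hC.image_mul_right h) hdisj, ?_⟩
    rw [Set.ncard_union_eq hdisj hC'.1 (hC.1.image _), hcard,
      Set.ncard_image_of_injective _ (mul_left_injective h), add_mul, one_mul]

end

/-- Proof of Lemma 2.6 (Moon, arXiv:1003.3998): for infinite countable amenable groups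
`G` and `H`, every `ε > 0`, every finite `F ⊆ G` and every finite `E ⊆ H`, there are a
finite non-empty `(ε, F)`-Følner subset `C' ⊆ G` and a finite non-empty `(ε, E)`-Følner
subset `D' ⊆ H` with `|C'| = |D'|`. -/
theorem exists_folner_sets_with_equal_card
    (G H : Type) [Group G] [Group H] [Countable G] [Countable H]
    [Infinite G] [Infinite H]
    (hG : AmenableGroup G) (hH : AmenableGroup H)
    (ε : ℝ) (hε : 0 < ε) (F : Finset G) (E : Finset H) :
    ∃ (C' : Set G) (D' : Set H),
      IsFolnerSet ε F C' ∧ IsFolnerSet ε E D' ∧ C'.ncard = D'.ncard := by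
  obtain ⟨C, hC⟩ := hG.exists_isFolnerSet hε F
  obtain ⟨D, hD⟩ := hH.exists_isFolnerSet hε E
  obtain ⟨C', hC', hCcard⟩ := hC.exists_ncard_eq_mul ((Set.ncard_pos hD.1).2 hD.2.1)
  obtain ⟨D', hD', hDcard⟩ := hD.exists_ncard_eq_mul ((Set.ncard_pos hC.1).2 hC.2.1)
  exact ⟨C', D', hC', hD', by rw [hCcard, hDcard, mul_comm]⟩
end

section
/- Let 1 → Z → G → Q → 1 be a central extension of countable groups, with p : G → Q the quotient map. Suppose there is a co-amenable subgroup H of Q such that H belongs to the class 𝒜 and such that the central extension 1 → Z → p⁻¹(H) → H → 1 splits (i.e., the restricted surjection p : p⁻¹(H) → H admits a group-homomorphism section). Then G belongs to the class 𝒜. -/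
/-- A finitely additive probability "measure" on all subsets of `X`. -/
structure IsMean {X : Type*} (μ : Set X → ℝ) : Prop where
  nonneg : ∀ S, 0 ≤ μ S
  univ : μ Set.univ = 1
  union : ∀ S T, Disjoint S T → μ (S ∪ T) = μ S + μ T

/-- The permutation `σ` preserves the set function `μ`. -/
def PreservesMean {X : Type*} (μ : Set X → ℝ) (σ : Equiv.Perm X) : Prop :=
  ∀ S, μ (σ '' S) = μ S

open Filter Topology

theorem isInvariantMean_iff {G X : Type*} [Group G] {φ : G →* Equiv.Perm X} {μ : Set X → ℝ} :
    IsInvariantMean φ μ ↔ IsMean μ ∧ ∀ g, PreservesMean μ (φ g) :=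
  ⟨fun ⟨h0, h1, h2, h3⟩ => ⟨⟨h0, h1, h2⟩, h3⟩, fun ⟨⟨h0, h1, h2⟩, h3⟩ => ⟨h0, h1, h2, h3⟩⟩

namespace IsMean

variable {X : Type*} {μ : Set X → ℝ}

theorem empty (h : IsMean μ) : μ ∅ = 0 := by
  have := h.union ∅ ∅ (by simp)
  simp only [Set.union_self] at this
  linarith

theorem le_one (h : IsMean μ) (S : Set X) : μ S ≤ 1 := by
  have h1 := h.union S Sᶜ disjoint_compl_right
  rw [Set.union_compl_self, h.univ] at h1
  linarith [h.nonneg Sᶜ]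

theorem nonempty (h : IsMean μ) : Nonempty X := by
  by_contra hX
  rw [not_nonempty_iff] at hX
  have h1 := h.univ
  rw [Set.univ_eq_empty_iff.2 hX, h.empty] at h1
  exact zero_ne_one h1

theorem map (h : IsMean μ) {Y : Type*} (j : X → Y) : IsMean fun S => μ (j ⁻¹' S) where
  nonneg _ := h.nonneg _
  univ := h.univ
  union _ _ hST := h.union _ _ (hST.preimage j)

end IsMean

theorem PreservesMean.map {X Y : Type*} {μ : Set X → ℝ} {τ : Equiv.Perm X} (h : PreservesMean μ τ)
    {σ : Equiv.Perm Y} {j : X → Y} (hj : ∀ x, j (τ x) = σ (j x)) :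
    PreservesMean (fun S => μ (j ⁻¹' S)) σ := by
  intro S
  change μ (j ⁻¹' (σ '' S)) = μ (j ⁻¹' S)
  rw [← h (j ⁻¹' S)]
  congr 1
  ext x
  obtain ⟨y, rfl⟩ := τ.surjective x
  simp [hj]

theorem PreservesMean.mul {X : Type*} {μ : Set X → ℝ} {σ τ : Equiv.Perm X}
    (hσ : PreservesMean μ σ) (hτ : PreservesMean μ τ) : PreservesMean μ (σ * τ) := by
  intro S
  rw [Equiv.Perm.coe_mul, Set.image_comp, hσ, hτ]

/-- A family of `[0, 1]`-valued functions converges pointwise along any ultrafilter. -/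
theorem exists_tendsto_ultrafilter {ι X : Type*} (U : Ultrafilter ι) (m : ι → X → ℝ)
    (h0 : ∀ i x, 0 ≤ m i x) (h1 : ∀ i x, m i x ≤ 1) :
    ∃ L : X → ℝ, ∀ x, Tendsto (fun i => m i x) U (𝓝 (L x)) := by
  have hK : IsCompact (Set.pi Set.univ fun _ : X => Set.Icc (0 : ℝ) 1) :=
    isCompact_univ_pi fun _ => isCompact_Icc
  obtain ⟨L, -, hL⟩ := hK.ultrafilter_le_nhds (U.map m) (by
    rw [le_principal_iff, Ultrafilter.mem_coe, Ultrafilter.mem_map]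
    exact univ_mem' fun i x _ => ⟨h0 i x, h1 i x⟩)
  exact ⟨L, tendsto_pi_nhds.1 hL⟩

theorem IsMean.of_tendsto {ι X : Type*} {l : Filter ι} [l.NeBot] {m : ι → Set X → ℝ}
    {L : Set X → ℝ} (hm : ∀ i, IsMean (m i)) (hL : ∀ S, Tendsto (fun i => m i S) l (𝓝 (L S))) :
    IsMean L where
  nonneg S := ge_of_tendsto' (hL S) fun i => (hm i).nonneg S
  univ := tendsto_nhds_unique (hL _) (by simp [(hm _).univ])
  union S T hST := tendsto_nhds_unique (hL _)
    (((hL S).add (hL T)).congr fun i => ((hm i).union S T hST).symm)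

theorem PreservesMean.of_tendsto {ι X : Type*} {l : Filter ι} [l.NeBot] {m : ι → Set X → ℝ}
    {L : Set X → ℝ} {σ : Equiv.Perm X} (hm : ∀ᶠ i in l, PreservesMean (m i) σ)
    (hL : ∀ S, Tendsto (fun i => m i S) l (𝓝 (L S))) : PreservesMean L σ := fun S =>
  tendsto_nhds_unique (hL _) ((hL S).congr' (hm.mono fun _ hi => (hi S).symm))

theorem IsMean.average {X : Type*} {m : ℕ → Set X → ℝ} (hm : ∀ i, IsMean (m i)) (n : ℕ) :
    IsMean fun S => (∑ i ∈ Finset.range (n + 1), m i S) / (n + 1) where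
  nonneg S := div_nonneg (Finset.sum_nonneg fun i _ => (hm i).nonneg S) (by positivity)
  univ := by
    simp only [(hm _).univ, Finset.sum_const, Finset.card_range, nsmul_eq_mul, mul_one]
    push_cast
    exact div_self (by positivity)
  union S T hST := by
    simp only [(hm _).union S T hST, Finset.sum_add_distrib, add_div]

/-- A mean can be averaged over the powers of a permutation `τ`, without losing its invariance
under permutations commuting with `τ`. -/
theorem IsMean.exists_preserves {X : Type*} {μ : Set X → ℝ} (hμ : IsMean μ) (τ : Equiv.Perm X) :
    ∃ ν, IsMean ν ∧ PreservesMean ν τ ∧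
      ∀ σ, Commute σ τ → PreservesMean μ σ → PreservesMean ν σ := by
  let m : ℕ → Set X → ℝ := fun i S => μ ((τ ^ i : Equiv.Perm X) ⁻¹' S)
  have hm : ∀ i, IsMean (m i) := fun i => hμ.map _
  have ha := IsMean.average hm
  obtain ⟨L, hL⟩ := exists_tendsto_ultrafilter (hyperfilter ℕ) _
    (fun n => (ha n).nonneg) fun n => (ha n).le_one
  refine ⟨L, .of_tendsto ha hL, fun S => ?_, fun σ hσ h => .of_tendsto (.of_forall fun n S => ?_) hL⟩
  · have hshift : ∀ i, m (i + 1) (τ '' S) = m i S := fun i => by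
      simp only [m]
      congr 1
      ext x
      simp [pow_succ']
    have hdiff : ∀ n : ℕ, |(∑ i ∈ Finset.range (n + 1), m i (τ '' S)) / (n + 1) -
        (∑ i ∈ Finset.range (n + 1), m i S) / (n + 1)| ≤ 1 / ((n : ℝ) + 1) := fun n => by
      have hsum : (∑ i ∈ Finset.range (n + 1), m i (τ '' S)) - ∑ i ∈ Finset.range (n + 1), m i S
          = m 0 (τ '' S) - m n S := by
        rw [Finset.sum_range_succ', Finset.sum_range_succ _ n]
        simp only [hshift]
        ring
      rw [← sub_div, hsum, abs_div, abs_of_pos (by positivity : (0 : ℝ) < n + 1)]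
      gcongr
      rw [abs_le]
      constructor <;>
        linarith [(hm 0).nonneg (τ '' S), (hm 0).le_one (τ '' S), (hm n).nonneg S, (hm n).le_one S]
    have hzero : Tendsto (fun n : ℕ => 1 / ((n : ℝ) + 1)) (hyperfilter ℕ) (𝓝 0) :=
      tendsto_one_div_add_atTop_nhds_zero_nat.mono_left Nat.hyperfilter_le_atTop
    exact sub_eq_zero.1 (tendsto_nhds_unique ((hL _).sub (hL S))
      (squeeze_zero_norm hdiff hzero))
  · have hσi : ∀ i, m i (σ '' S) = m i S := fun i =>
      h.map (fun x => by
        rw [← Equiv.Perm.mul_apply, ← Equiv.Perm.mul_apply, (hσ.pow_right i).eq]) S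
    simp only [hσi]

/-- Markov–Kakutani for means: a mean can be made invariant under a commuting set `C` of
permutations, without losing its invariance under permutations commuting with `C`. -/
theorem IsMean.exists_preserves_of_commute {X : Type*} {μ : Set X → ℝ} (hμ : IsMean μ)
    {C : Set (Equiv.Perm X)} (hC : ∀ σ ∈ C, ∀ τ ∈ C, Commute σ τ) :
    ∃ ν, IsMean ν ∧ (∀ σ ∈ C, PreservesMean ν σ) ∧
      ∀ σ, (∀ τ ∈ C, Commute σ τ) → PreservesMean μ σ → PreservesMean ν σ := by
  classical
  have hfin : ∀ F : Finset C, ∃ ν, IsMean ν ∧ (∀ σ ∈ F, PreservesMean ν (σ : Equiv.Perm X)) ∧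
      ∀ σ, (∀ τ ∈ C, Commute σ τ) → PreservesMean μ σ → PreservesMean ν σ := by
    intro F
    induction F using Finset.induction_on with
    | empty => exact ⟨μ, hμ, by simp, fun _ _ h => h⟩
    | insert τ F _ ih =>
      obtain ⟨ν, hν, hF, hc⟩ := ih
      obtain ⟨ν', hν', hτ, hc'⟩ := hν.exists_preserves τ
      refine ⟨ν', hν', fun σ hσ => ?_, fun σ hσ h => hc' σ (hσ τ τ.2) (hc σ hσ h)⟩
      rcases Finset.mem_insert.1 hσ with rfl | hσ
      · exact hτ
      · exact hc' σ (hC σ σ.2 τ τ.2) (hF σ hσ)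
  choose m hm hF hc using hfin
  obtain ⟨L, hL⟩ := exists_tendsto_ultrafilter (Ultrafilter.of (atTop : Filter (Finset C))) m
    (fun F => (hm F).nonneg) fun F => (hm F).le_one
  refine ⟨L, .of_tendsto hm hL, fun σ hσ => .of_tendsto ?_ hL,
    fun σ hσ h => .of_tendsto (.of_forall fun F => hc F σ hσ h) hL⟩
  refine Ultrafilter.of_le _ ((eventually_ge_atTop {⟨σ, hσ⟩}).mono fun F hle => ?_)
  exact hF F ⟨σ, hσ⟩ (hle (Finset.mem_singleton_self _))

section SimpleIntegral

open MeasureTheory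

variable {A : Type*} [MeasurableSpace A] {μ : Set A → ℝ}

/-- Integration of simple functions against a mean. -/
noncomputable def simpleIntegral (μ : Set A → ℝ) (f : SimpleFunc A ℝ) : ℝ :=
  f.setToSimpleFunc fun S => μ S • ContinuousLinearMap.id ℝ ℝ

theorem IsMean.finMeasAdditive (hμ : IsMean μ) :
    FinMeasAdditive (0 : Measure A) fun S => μ S • ContinuousLinearMap.id ℝ ℝ :=
  fun S T _ _ _ _ hST => by simp only [hμ.union S T hST, add_smul]

theorem simpleIntegral_add (hμ : IsMean μ) (f g : SimpleFunc A ℝ) :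
    simpleIntegral μ (f + g) = simpleIntegral μ f + simpleIntegral μ g :=
  SimpleFunc.setToSimpleFunc_add _ hμ.finMeasAdditive integrable_zero_measure
    integrable_zero_measure

theorem simpleIntegral_mono (hμ : IsMean μ) {f g : SimpleFunc A ℝ} (hfg : ∀ a, f a ≤ g a) :
    simpleIntegral μ f ≤ simpleIntegral μ g :=
  SimpleFunc.setToSimpleFunc_mono hμ.finMeasAdditive
    (fun S _ _ _ hx => mul_nonneg (hμ.nonneg S) hx) integrable_zero_measure
    integrable_zero_measure hfg

theorem simpleIntegral_const (hμ : IsMean μ) (c : ℝ) :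
    simpleIntegral μ (SimpleFunc.const A c) = c := by
  have := hμ.nonempty
  have hc : Function.const A c ⁻¹' {c} = Set.univ := by simp [Function.const_def]
  simp [simpleIntegral, SimpleFunc.setToSimpleFunc, hc, hμ.univ]

theorem simpleIntegral_comp {σ : Equiv.Perm A} (hσ : PreservesMean μ σ)
    {f g : SimpleFunc A ℝ} (hfg : ∀ a, g a = f (σ a)) :
    simpleIntegral μ g = simpleIntegral μ f := by
  have hrange : g.range = f.range := by
    ext y
    simp only [SimpleFunc.mem_range, Set.mem_range, hfg]
    exact ⟨fun ⟨a, ha⟩ => ⟨_, ha⟩, fun ⟨a, ha⟩ => ⟨σ.symm a, by simpa using ha⟩⟩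
  simp only [simpleIntegral, SimpleFunc.setToSimpleFunc, hrange]
  refine Finset.sum_congr rfl fun y _ => ?_
  rw [← hσ (g ⁻¹' {y})]
  congr 3
  ext a
  obtain ⟨b, rfl⟩ := σ.surjective a
  simp [hfg]

variable [DiscreteMeasurableSpace A]

/-- The approximation of a `[0, 1]`-valued function by the multiples of `1 / (n + 1)` below it. -/
noncomputable def floorApprox (n : ℕ) (f : A → ℝ) : SimpleFunc A ℝ where
  toFun a := (min ⌊((n : ℝ) + 1) * f a⌋₊ (n + 1) : ℕ) / ((n : ℝ) + 1)
  measurableSet_fiber' _ := .of_discrete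
  finite_range' := by
    refine ((Set.finite_Iic (n + 1)).image fun k : ℕ => (k : ℝ) / ((n : ℝ) + 1)).subset ?_
    rintro _ ⟨a, rfl⟩
    exact ⟨_, Set.mem_Iic.2 (min_le_right _ _), rfl⟩

theorem floorApprox_nonneg (n : ℕ) (f : A → ℝ) (a : A) : 0 ≤ floorApprox n f a :=
  div_nonneg (Nat.cast_nonneg _) (by positivity)

theorem floorApprox_le_one (n : ℕ) (f : A → ℝ) (a : A) : floorApprox n f a ≤ 1 := by
  refine (div_le_one (by positivity)).2 ?_
  exact_mod_cast min_le_right _ _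

theorem floorApprox_bounds (n : ℕ) {f : A → ℝ} {a : A} (h0 : 0 ≤ f a) (h1 : f a ≤ 1) :
    floorApprox n f a ≤ f a ∧ f a ≤ floorApprox n f a + 1 / ((n : ℝ) + 1) := by
  have hn : (0 : ℝ) < n + 1 := by positivity
  have hmin : min ⌊((n : ℝ) + 1) * f a⌋₊ (n + 1) = ⌊((n : ℝ) + 1) * f a⌋₊ := by
    refine min_eq_left (Nat.floor_le_of_le ?_)
    push_cast
    nlinarith
  have hval : floorApprox n f a = (⌊((n : ℝ) + 1) * f a⌋₊ : ℝ) / ((n : ℝ) + 1) := by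
    rw [← hmin]
    rfl
  rw [hval, ← add_div, div_le_iff₀ hn, le_div_iff₀ hn]
  constructor
  · linarith [Nat.floor_le (mul_nonneg hn.le h0)]
  · linarith [Nat.lt_floor_add_one (((n : ℝ) + 1) * f a)]

end SimpleIntegral

/-- A mean extends to a finitely additive integral of `[0, 1]`-valued functions. -/
theorem IsMean.exists_integral {A : Type*} {μ : Set A → ℝ} (hμ : IsMean μ) :
    ∃ I : (A → ℝ) → ℝ,
    (∀ f, 0 ≤ I f) ∧ I 1 = 1 ∧
    (∀ f g, (∀ a, 0 ≤ f a) → (∀ a, 0 ≤ g a) → (∀ a, f a + g a ≤ 1) → I (f + g) = I f + I g) ∧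
    ∀ σ : Equiv.Perm A, PreservesMean μ σ → ∀ f, I (f ∘ σ) = I f := by
  let _ : MeasurableSpace A := ⊤
  have h0 : ∀ n (f : A → ℝ), 0 ≤ simpleIntegral μ (floorApprox n f) := fun n f =>
    (simpleIntegral_const hμ 0).symm.le.trans (simpleIntegral_mono hμ (floorApprox_nonneg n f))
  have h1 : ∀ n (f : A → ℝ), simpleIntegral μ (floorApprox n f) ≤ 1 := fun n f =>
    (simpleIntegral_mono hμ (floorApprox_le_one n f)).trans (simpleIntegral_const hμ 1).le
  have hzero : Tendsto (fun n : ℕ => 1 / ((n : ℝ) + 1)) (hyperfilter ℕ) (𝓝 0) :=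
    tendsto_one_div_add_atTop_nhds_zero_nat.mono_left Nat.hyperfilter_le_atTop
  obtain ⟨I, hI⟩ := exists_tendsto_ultrafilter (hyperfilter ℕ) _ h0 h1
  refine ⟨I, fun f => ge_of_tendsto' (hI f) fun n => h0 n f, ?_, fun f g hf hg hfg => ?_,
    fun σ hσ f => ?_⟩
  · refine le_antisymm (le_of_tendsto' (hI 1) fun n => h1 n 1) ?_
    have hlim := (hI 1).add hzero
    rw [add_zero] at hlim
    refine ge_of_tendsto' hlim fun n => ?_
    rw [← simpleIntegral_const hμ (1 / ((n : ℝ) + 1)), ← simpleIntegral_add hμ]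
    refine (simpleIntegral_const hμ 1).symm.le.trans (simpleIntegral_mono hμ fun a => ?_)
    exact (floorApprox_bounds (f := 1) n zero_le_one le_rfl).2
  · have bf := fun n a => floorApprox_bounds n (hf a) (by linarith [hfg a, hg a])
    have bg := fun n a => floorApprox_bounds n (hg a) (by linarith [hfg a, hf a])
    have bfg := fun n a => floorApprox_bounds (f := f + g) n (add_nonneg (hf a) (hg a)) (hfg a)
    apply le_antisymm
    · have hlim := (((hI f).add (hI g)).add hzero).add hzero
      rw [add_zero, add_zero] at hlim
      refine le_of_tendsto_of_tendsto' (hI _) hlim fun n => ?_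
      rw [← simpleIntegral_const hμ (1 / ((n : ℝ) + 1))]
      simp only [← simpleIntegral_add hμ]
      refine simpleIntegral_mono hμ fun a => ?_
      have := (bfg n a).1
      simp only [MeasureTheory.SimpleFunc.coe_add, Pi.add_apply, MeasureTheory.SimpleFunc.const_apply] at this ⊢
      linarith [(bf n a).2, (bg n a).2]
    · have hlim := (hI (f + g)).add hzero
      rw [add_zero] at hlim
      refine le_of_tendsto_of_tendsto' ((hI f).add (hI g)) hlim fun n => ?_
      rw [← simpleIntegral_const hμ (1 / ((n : ℝ) + 1))]
      simp only [← simpleIntegral_add hμ]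
      refine simpleIntegral_mono hμ fun a => ?_
      have := (bfg n a).2
      simp only [MeasureTheory.SimpleFunc.coe_add, Pi.add_apply, MeasureTheory.SimpleFunc.const_apply] at this ⊢
      linarith [(bf n a).1, (bg n a).1]
  · exact tendsto_nhds_unique (hI _)
      ((hI f).congr fun n => (simpleIntegral_comp hσ fun _ => rfl).symm)

/-- If `G` acts transitively and amenably on `A`, then an action of `G` preserving a mean under
the stabilizer of a point of `A` is amenable. -/
theorem AmenableAction.of_stabilizer {G A X : Type*} [Group G] {α : G →* Equiv.Perm A}
    {β : G →* Equiv.Perm X} (hα : AmenableAction α) (a₀ : A) (htrans : ∀ a, ∃ g, α g a₀ = a)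
    {m : Set X → ℝ} (hm : IsMean m) (hstab : ∀ g, α g a₀ = a₀ → PreservesMean m (β g)) :
    AmenableAction β := by
  obtain ⟨μ, hμ⟩ := hα
  obtain ⟨hμ, hμα⟩ := isInvariantMean_iff.1 hμ
  obtain ⟨I, hI0, hI1, hIadd, hIcomp⟩ := hμ.exists_integral
  choose t ht using htrans
  let F : Set X → A → ℝ := fun S a => m (β (t a) ⁻¹' S)
  have hF : ∀ S a g, α g a₀ = a → F S a = m (β g ⁻¹' S) := by
    rintro S _ g rfl
    have hg := hstab (g⁻¹ * t (α g a₀)) (by simp [ht])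
    change m _ = m _
    rw [← hg]
    congr 1
    ext x
    rw [Equiv.image_eq_preimage_symm]
    simp [← Equiv.Perm.inv_def]
  refine ⟨fun S => I (F S), isInvariantMean_iff.2 ⟨⟨fun S => hI0 _, ?_, fun S T hST => ?_⟩,
    fun g S => ?_⟩⟩
  · rw [← hI1]
    congr 1
    ext a
    exact hm.univ
  · have hadd : F (S ∪ T) = F S + F T := by
      ext a
      exact hm.union _ _ (hST.preimage _)
    change I (F (S ∪ T)) = I (F S) + I (F T)
    rw [hadd]
    refine hIadd _ _ (fun a => hm.nonneg _) (fun a => hm.nonneg _) fun a => ?_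
    rw [← Pi.add_apply, ← hadd]
    exact hm.le_one _
  · change I (F (β g '' S)) = I (F S)
    rw [← hIcomp (α g) (hμα g)]
    congr 1
    ext a
    rw [Function.comp_apply, hF _ (α g a) (g * t a) (by simp [ht])]
    change m _ = m _
    congr 1
    ext x
    simp

/-- Lemma 2.13 (Moon, arXiv:1003.3998).
Let `1 → Z → G → Q → 1` be a central extension of countable groups (given by an injective
homomorphism `ι : Z → G` with central image and a surjective `p : G → Q` with
`ker p = im ι`). Suppose there is a co-amenable subgroup `H ≤ Q` (i.e. the `Q`-action on
`Q/H` is amenable) such that `H` is in the class `𝒜` and the central extension splits over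
`H` (the restricted surjection `p⁻¹(H) → H` admits a group-homomorphism section). Then `G`
is in the class `𝒜`. -/
theorem central_extension_split_over_coamenable_mem_classA
    (Z G Q : Type) [Group Z] [Group G] [Group Q]
    [Countable Z] [Countable G] [Countable Q]
    (ι : Z →* G) (p : G →* Q)
    (hι : Function.Injective ι) (hp : Function.Surjective p)
    (hexact : p.ker = ι.range)
    (hcentral : ι.range ≤ Subgroup.center G)
    (H : Subgroup Q)
    (hco : AmenableAction (MulAction.toPermHom Q (Q ⧸ H)))
    (hHA : InClassA H)
    (hsplit : ∃ s : H →* G, ∀ h : H, p (s h) = (h : Q)) :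
    InClassA G := by
  obtain ⟨X, _, φ, hφ, htrans, μ, hμ⟩ := hHA
  obtain ⟨hμ, hμφ⟩ := isInvariantMean_iff.1 hμ
  obtain ⟨s, hs⟩ := hsplit
  obtain ⟨x₀⟩ := hμ.nonempty
  let L : Subgroup H := (MulAction.stabilizer (Equiv.Perm X) x₀).comap φ
  let K : Subgroup G := L.map s
  let β : G →* Equiv.Perm (G ⧸ K) := MulAction.toPermHom G (G ⧸ K)
  have hβ : ∀ g a : G, β g (a : G ⧸ K) = ((g * a : G) : G ⧸ K) := fun _ _ => rfl
  have hz : ∀ z ∈ p.ker, ∀ g, z * g = g * z := fun z hz g =>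
    ((Subgroup.mem_center_iff.1 (hcentral (hexact ▸ hz))) g).symm
  refine ⟨G ⧸ K, QuotientGroup.mk_surjective.countable, β, ?_, fun x y => MulAction.exists_smul_eq G x y, ?_⟩
  · refine (injective_iff_map_eq_one β).2 fun g hg => ?_
    have hconj : ∀ a : G, a⁻¹ * g * a ∈ K := fun a => by
      have h := Equiv.congr_fun hg (a : G ⧸ K)
      rw [hβ] at h
      rw [mul_assoc]
      exact QuotientGroup.eq.1 h.symm
    obtain ⟨h, -, rfl⟩ : g ∈ K := by simpa using hconj 1
    suffices h = 1 by rw [this, map_one]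
    refine hφ (Equiv.ext fun x => ?_)
    obtain ⟨k, rfl⟩ := htrans x₀ x
    obtain ⟨l, hl, hlk⟩ := hconj (s k)
    have hlk' : l = k⁻¹ * h * k := by
      have := congrArg p hlk
      rw [← map_inv, ← map_mul, ← map_mul, hs, hs] at this
      exact Subtype.ext this
    have hfix : φ l x₀ = x₀ := hl
    rw [hlk', map_mul, map_mul, map_inv, Equiv.Perm.mul_apply, Equiv.Perm.mul_apply,
      Equiv.Perm.inv_eq_iff_eq] at hfix
    rw [hfix, map_one, Equiv.Perm.one_apply]
  · choose t ht using htrans x₀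
    let j : X → G ⧸ K := fun x => (s (t x) : G)
    have hj : ∀ h x, j (φ h x) = β (s h) (j x) := fun h x => by
      refine Eq.symm (QuotientGroup.eq.2 ⟨(h * t x)⁻¹ * t (φ h x), ?_, by simp⟩)
      change φ ((h * t x)⁻¹ * t (φ h x)) x₀ = x₀
      rw [map_mul, map_inv, Equiv.Perm.mul_apply, ht, Equiv.Perm.inv_eq_iff_eq, map_mul,
        Equiv.Perm.mul_apply, ht]
    have hcomm : ∀ g, ∀ τ ∈ β '' (p.ker : Set G), Commute (β g) τ := by
      rintro g _ ⟨z, hzk, rfl⟩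
      exact Commute.map (hz z hzk g).symm β
    obtain ⟨m, hm, hmZ, hmH⟩ := (hμ.map j).exists_preserves_of_commute
      (C := β '' (p.ker : Set G)) (by rintro _ ⟨z, -, rfl⟩; exact hcomm z)
    have hα : AmenableAction ((MulAction.toPermHom Q (Q ⧸ H)).comp p) := by
      obtain ⟨ν, h0, h1, h2, h3⟩ := hco
      exact ⟨ν, h0, h1, h2, fun g => h3 (p g)⟩
    refine hα.of_stabilizer ((1 : Q) : Q ⧸ H) (fun a => ?_) hm fun g hg => ?_
    · obtain ⟨q, rfl⟩ := MulAction.exists_smul_eq Q ((1 : Q) : Q ⧸ H) a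
      obtain ⟨g, rfl⟩ := hp q
      exact ⟨g, rfl⟩
    · have hgH : p g ∈ H := by
        have h : ((p g * 1 : Q) : Q ⧸ H) = (1 : Q) := hg
        simpa using QuotientGroup.eq.1 h.symm
      have hker : g * (s ⟨p g, hgH⟩)⁻¹ ∈ p.ker := by simp [MonoidHom.mem_ker, hs]
      rw [← inv_mul_cancel_right g (s ⟨p g, hgH⟩), map_mul]
      exact (hmZ _ ⟨_, hker, rfl⟩).mul
        (hmH _ (hcomm _) ((hμφ ⟨p g, hgH⟩).map (hj _)))
end
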